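/- arXiv:1409.5842 — 4 statements merged into one kernel-verified Lean document; each statement's English description precedes it below -/
import Mathlib

section
/- Let q be a prime power and S a surface of degree d in P^3 over F_q without F_q-plane components, with 2 ≤ d ≤ q+1 and N_q(S) = (d-1)q^2 + dq + 1. Then S is projectively equivalent over F_q to one of the following surfaces: (i) X_0X_1 − X_2X_3 = 0 if d = 2; (ii) X_0^{√q+1} + X_1^{√q+1} + X_2^{√q+1} + X_3^{√q+1} = 0 if d = √q + 1 (q a square); (iii) X_0X_1^q − X_0^qX_1 + X_2X_3^q − X_2^qX_3 = 0 if d = q + 1. -/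
open MvPolynomial

variable {K : Type} [Field K]

/-- The linear form `∑ aᵢ Xᵢ` as a multivariate polynomial. -/
noncomputable def linForm {n : ℕ} (a : Fin n → K) : MvPolynomial (Fin n) K :=
  ∑ i, C (a i) * X i

/-- The linear form `v ↦ ∑ aᵢ vᵢ` as a linear map. -/
noncomputable def linMap {n : ℕ} (a : Fin n → K) : (Fin n → K) →ₗ[K] K :=
  ∑ i, a i • LinearMap.proj i

/-- Substitution `F(M·X)` of a linear change of variables into `F`. -/
noncomputable def substLin {n : ℕ} (M : Matrix (Fin n) (Fin n) K)
    (F : MvPolynomial (Fin n) K) : MvPolynomial (Fin n) K :=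
  MvPolynomial.aeval (fun i => ∑ j, C (M i j) * X j) F

/-- Projective equivalence over `K` of two forms. -/
def ProjEquiv {n : ℕ} (F G : MvPolynomial (Fin n) K) : Prop :=
  ∃ M : Matrix (Fin n) (Fin n) K, IsUnit M.det ∧
    ∃ c : K, c ≠ 0 ∧ substLin M F = C c * G

/-- An `F_q`-line in `P^3` (resp. `P^2`), as a 2-dimensional linear subspace. -/
def IsLine {n : ℕ} (W : Submodule K (Fin n → K)) : Prop := Module.finrank K W = 2

/-- An `F_q`-plane in `P^3`, as a 3-dimensional linear subspace. -/
def IsPlane (W : Submodule K (Fin 4 → K)) : Prop := Module.finrank K W = 3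

/-- The section `S ∩ H` of the surface `S = {F = 0}` with the plane `H` given by the
subspace `W` is a planar `F_q`-pencil of degree `d` with vertex `P`: modulo the linear
form defining `H`, `F` is a nonzero scalar times a product of `d` linear forms over `F_q`
cutting out `d` pairwise distinct lines of `H`, all passing through the point `P`. -/
def IsPencil (F : MvPolynomial (Fin 4) K) (d : ℕ)
    (W : Submodule K (Fin 4 → K)) (P : Projectivization K (Fin 4 → K)) : Prop :=
  ∃ (a : Fin 4 → K) (m : Fin d → Fin 4 → K) (c : K) (g : MvPolynomial (Fin 4) K),
    a ≠ 0 ∧ W = LinearMap.ker (linMap a) ∧ c ≠ 0 ∧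
    F = C c * (∏ i, linForm (m i)) + linForm a * g ∧
    (∀ i, IsLine (LinearMap.ker (linMap a) ⊓ LinearMap.ker (linMap (m i)))) ∧
    (∀ i j, i ≠ j →
      LinearMap.ker (linMap a) ⊓ LinearMap.ker (linMap (m i)) ≠
      LinearMap.ker (linMap a) ⊓ LinearMap.ker (linMap (m j))) ∧
    P.rep ∈ W ∧ (∀ i, linMap (m i) P.rep = 0)

/-- The restriction of `F` to the plane `H` given by the subspace `W` has a linear
factor over `F_q` (i.e. the section `S ∩ H` has an `F_q`-line component). -/
def SectionHasLineComp (F : MvPolynomial (Fin 4) K)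
    (W : Submodule K (Fin 4 → K)) : Prop :=
  ∃ (a b : Fin 4 → K) (h g : MvPolynomial (Fin 4) K),
    a ≠ 0 ∧ W = LinearMap.ker (linMap a) ∧
    IsLine (LinearMap.ker (linMap a) ⊓ LinearMap.ker (linMap b)) ∧
    F = linForm b * h + linForm a * g

/-- Functions on `V` that are homogeneous polynomials of degree `d` in linear forms. -/
inductive IsForm {V : Type} [AddCommGroup V] [Module K V] : ℕ → (V → K) → Prop
  | const (c : K) : IsForm 0 fun _ => c
  | mul {d : ℕ} {f : V → K} (l : V →ₗ[K] K) : IsForm d f → IsForm (d + 1) fun x => l x * f x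
  | add {d : ℕ} {f g : V → K} : IsForm d f → IsForm d g → IsForm d fun x => f x + g x

namespace IsForm

variable {V W : Type} [AddCommGroup V] [Module K V] [AddCommGroup W] [Module K W]

theorem zero : ∀ d : ℕ, IsForm d fun _ : V => (0 : K)
  | 0 => const 0
  | d + 1 => by simpa using mul 0 (zero d)

theorem const_mul {d : ℕ} {f : V → K} (hf : IsForm d f) (c : K) :
    IsForm d fun x => c * f x := by
  induction hf with
  | const a => exact const (c * a)
  | mul l _ ih => simpa [mul_left_comm] using mul l ih
  | add _ _ ih₁ ih₂ => simpa [mul_add] using add ih₁ ih₂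

theorem sum {ι : Type} {d : ℕ} {f : ι → V → K} (s : Finset ι) (hf : ∀ i ∈ s, IsForm d (f i)) :
    IsForm d fun x => ∑ i ∈ s, f i x := by
  classical
  induction s using Finset.induction_on with
  | empty => simpa using zero d
  | insert a s ha ih =>
    simp only [Finset.sum_insert ha]
    exact add (hf _ (by simp)) (ih fun i hi => hf i (by simp [hi]))

theorem linear_pow (l : V →ₗ[K] K) : ∀ d : ℕ, IsForm d fun x => l x ^ d
  | 0 => by simpa using const 1
  | d + 1 => by simpa [pow_succ'] using mul l (linear_pow l d)

theorem comp {d : ℕ} {f : V → K} (hf : IsForm d f) (φ : W →ₗ[K] V) :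
    IsForm d fun x => f (φ x) := by
  induction hf with
  | const a => exact const a
  | mul l _ ih => exact mul (l ∘ₗ φ) ih
  | add _ _ ih₁ ih₂ => exact add ih₁ ih₂

theorem map_smul {d : ℕ} {f : V → K} (hf : IsForm d f) (c : K) (x : V) :
    f (c • x) = c ^ d * f x := by
  induction hf with
  | const a => simp
  | mul l _ ih => beta_reduce; rw [ih, LinearMap.map_smul, smul_eq_mul]; ring
  | add _ _ ih₁ ih₂ => beta_reduce; rw [ih₁, ih₂]; ring

theorem map_zero {d : ℕ} {f : V → K} (hf : IsForm (d + 1) f) : f 0 = 0 := by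
  simpa using hf.map_smul 0 0

/-- A form has a polar form `D`, whose value at `(x, y)` is the linear coefficient of the
restriction of the form to the line `t ↦ x + t • y`. -/
theorem exists_polar_aux {d : ℕ} {f : V → K} (hf : IsForm d f) :
    ∃ D : V → V →ₗ[K] K,
      ((d = 0 → ∀ x, D x = 0) ∧ ∀ k, d = k + 1 → ∀ y, IsForm k fun x => D x y) ∧
      (∀ x, D x x = d * f x) ∧
      ∀ x y, ∃ p : Polynomial K, p.natDegree ≤ d ∧ p.coeff d = f y ∧ p.coeff 1 = D x y ∧
        ∀ t, p.eval t = f (x + t • y) := by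
  induction hf with
  | const c =>
    refine ⟨fun _ => 0, ⟨by simp, by simp⟩, by simp, fun x y => ⟨Polynomial.C c, ?_⟩⟩
    simp [Polynomial.coeff_C]
  | @mul d f l hf ih =>
    obtain ⟨D, ⟨h₀, h₁⟩, h₂, h₃⟩ := ih
    refine ⟨fun x => f x • l + l x • D x, ⟨by simp, ?_⟩, ?_, ?_⟩
    · intro k hk y
      obtain rfl : d = k := by omega
      refine add (f := fun x => f x * l y) (by simpa [mul_comm] using hf.const_mul (l y)) ?_
      rcases Nat.eq_zero_or_pos d with rfl | hd
      · simpa [h₀ rfl] using zero 0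
      · obtain ⟨k, rfl⟩ : ∃ k, d = k + 1 := ⟨d - 1, by omega⟩
        exact mul l (h₁ k rfl y)
    · intro x
      simp [h₂]
      ring
    · intro x y
      obtain ⟨p, hp₁, hp₂, hp₃, hp₄⟩ := h₃ x y
      have hp₀ : p.coeff 0 = f x := by simpa [Polynomial.coeff_zero_eq_eval_zero] using hp₄ 0
      refine ⟨Polynomial.C (l x) * p + Polynomial.C (l y) * (p * Polynomial.X), ?_, ?_, ?_, ?_⟩
      · refine Polynomial.natDegree_add_le_of_degree_le ?_ ?_
        · exact (Polynomial.natDegree_C_mul_le _ _).trans (by omega)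
        · refine (Polynomial.natDegree_C_mul_le _ _).trans ?_
          refine Polynomial.natDegree_mul_le.trans ?_
          have := Polynomial.natDegree_X_le (R := K)
          omega
      · rw [Polynomial.coeff_add, Polynomial.coeff_C_mul, Polynomial.coeff_C_mul,
          Polynomial.coeff_mul_X, hp₂, Polynomial.coeff_eq_zero_of_natDegree_lt (by omega)]
        simp
      · rw [Polynomial.coeff_add, Polynomial.coeff_C_mul, Polynomial.coeff_C_mul,
          show (1 : ℕ) = 0 + 1 from rfl, Polynomial.coeff_mul_X, hp₀, zero_add, hp₃]
        simp
        ring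
      · intro t
        simp [hp₄]
        ring
  | @add d f g hf hg ih₁ ih₂ =>
    obtain ⟨D, ⟨h₀, h₁⟩, h₂, h₃⟩ := ih₁
    obtain ⟨E, ⟨k₀, k₁⟩, k₂, k₃⟩ := ih₂
    refine ⟨fun x => D x + E x, ⟨fun h x => by simp [h₀ h, k₀ h], fun k hk y =>
      add (h₁ k hk y) (k₁ k hk y)⟩, fun x => by simp [h₂, k₂]; ring, fun x y => ?_⟩
    obtain ⟨p, hp₁, hp₂, hp₃, hp₄⟩ := h₃ x y
    obtain ⟨r, hr₁, hr₂, hr₃, hr₄⟩ := k₃ x y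
    exact ⟨p + r, Polynomial.natDegree_add_le_of_degree_le hp₁ hr₁, by simp [hp₂, hr₂],
      by simp [hp₃, hr₃], fun t => by simp [hp₄, hr₄]⟩

theorem exists_line {d : ℕ} {f : V → K} (hf : IsForm d f) (x y : V) :
    ∃ p : Polynomial K, p.natDegree ≤ d ∧ p.coeff d = f y ∧ ∀ t, p.eval t = f (x + t • y) := by
  obtain ⟨D, -, -, h⟩ := hf.exists_polar_aux
  obtain ⟨p, h₁, h₂, -, h₃⟩ := h x y
  exact ⟨p, h₁, h₂, h₃⟩

theorem exists_remainder {d : ℕ} {f : V → K} (hf : IsForm d f) (ψ : V →ₗ[K] K) (w : V) :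
    ∃ g : V → K, ((d = 0 → ∀ x, g x = 0) ∧ ∀ k, d = k + 1 → IsForm k g) ∧
      ∀ x, f x = f (x - ψ x • w) + ψ x * g x := by
  induction hf with
  | const c => exact ⟨fun _ => 0, by simp, by simp⟩
  | @mul d f l hf ih =>
    obtain ⟨g, ⟨h₀, h₁⟩, h₂⟩ := ih
    refine ⟨fun x => l w * f (x - ψ x • w) + l x * g x, ⟨by simp, ?_⟩, ?_⟩
    · intro k hk
      obtain rfl : d = k := by omega
      refine add (const_mul (hf.comp (LinearMap.id - ψ.smulRight w)) (l w)) ?_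
      rcases Nat.eq_zero_or_pos d with rfl | hd
      · simpa [h₀ rfl] using zero 0
      · obtain ⟨k, rfl⟩ : ∃ k, d = k + 1 := ⟨d - 1, by omega⟩
        exact mul l (h₁ k rfl)
    · intro x
      beta_reduce
      rw [h₂ x]
      simp
      ring
  | @add d f g hf hg ih₁ ih₂ =>
    obtain ⟨a, ⟨h₀, h₁⟩, h₂⟩ := ih₁
    obtain ⟨b, ⟨k₀, k₁⟩, k₂⟩ := ih₂
    refine ⟨fun x => a x + b x, ⟨fun h x => by simp [h₀ h, k₀ h], fun k hk =>
      add (h₁ k hk) (k₁ k hk)⟩, fun x => ?_⟩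
    beta_reduce
    rw [h₂ x, k₂ x]
    ring

/-- A form vanishing on the kernel of a nonzero linear form is divisible by it. -/
theorem exists_eq_mul {d : ℕ} {f : V → K} (hf : IsForm (d + 1) f) {ψ : V →ₗ[K] K} (hψ : ψ ≠ 0)
    (h : ∀ x, ψ x = 0 → f x = 0) : ∃ g : V → K, IsForm d g ∧ ∀ x, f x = ψ x * g x := by
  obtain ⟨v, hv⟩ : ∃ v, ψ v ≠ 0 := by
    by_contra! hc
    exact hψ (LinearMap.ext hc)
  obtain ⟨g, hg, hfg⟩ := hf.exists_remainder ψ ((ψ v)⁻¹ • v)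
  refine ⟨g, hg.2 d rfl, fun x => ?_⟩
  rw [hfg x, h, zero_add]
  simp [hv]

end IsForm

theorem Polynomial.eq_zero_of_forall_eval [Fintype K] {p : Polynomial K}
    (hp : p.natDegree < Fintype.card K) (h : ∀ t, p.eval t = 0) : p = 0 := by
  by_contra hne
  have := Polynomial.card_roots' p
  have h2 := Polynomial.card_le_degree_of_subset_roots (p := p) (Z := Finset.univ)
    (by intro t _; simpa [hne] using h t)
  rw [Finset.card_univ] at h2
  omega

theorem Polynomial.card_filter_eval_le [Fintype K] [DecidableEq K] {p : Polynomial K}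
    (hp : p ≠ 0) : (Finset.univ.filter fun t => p.eval t = 0).card ≤ p.natDegree :=
  Polynomial.card_le_degree_of_subset_roots (by intro t ht; simpa [hp] using ht)

section Plane

variable [Fintype K]

theorem exists_eq_linear_mul {e : ℕ} {h : K × K × K → K} (hh : IsForm (e + 1) h)
    (he : e + 1 < Fintype.card K) {l m r : K} (hlm : l ≠ 0 ∨ m ≠ 0)
    (hz : ∀ a b, l * a + m * b + r = 0 → h (a, b, 1) = 0) :
    ∃ g : K × K × K → K, IsForm e g ∧
      ∀ a b c, h (a, b, c) = (l * a + m * b + r * c) * g (a, b, c) := by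
  let ψ : K × K × K →ₗ[K] K := l • LinearMap.fst K K (K × K) +
    m • (LinearMap.fst K K K ∘ₗ LinearMap.snd K K (K × K)) +
    r • (LinearMap.snd K K K ∘ₗ LinearMap.snd K K (K × K))
  have hψ : ∀ a b c, ψ (a, b, c) = l * a + m * b + r * c := fun a b c => by simp [ψ]
  have hψ0 : ψ ≠ 0 := by
    intro h0
    have h1 := hψ 1 0 0
    have h2 := hψ 0 1 0
    rw [h0] at h1 h2
    simp at h1 h2
    tauto
  obtain ⟨g, hg, hgz⟩ := hh.exists_eq_mul hψ0 (by
    rintro ⟨a, b, c⟩ hx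
    rw [hψ] at hx
    by_cases hc : c = 0
    · subst hc
      obtain ⟨a₀, b₀, h₀⟩ : ∃ a₀ b₀, l * a₀ + m * b₀ + r = 0 := by
        rcases hlm with h | h
        · exact ⟨-r / l, 0, by field_simp; ring⟩
        · exact ⟨0, -r / m, by field_simp; ring⟩
      obtain ⟨p, hp₁, hp₂, hp₃⟩ := hh.exists_line (a₀, b₀, 1) (a, b, 0)
      have hp : p = 0 := Polynomial.eq_zero_of_forall_eval (by omega) fun t => by
        rw [hp₃]
        simp only [Prod.smul_mk, Prod.mk_add_mk, smul_eq_mul, mul_zero, add_zero]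
        apply hz
        linear_combination h₀ + t * hx
      simpa [hp] using hp₂.symm
    · have := hh.map_smul c (a / c, b / c, 1)
      rw [hz _ _ (by field_simp; linear_combination hx), mul_zero] at this
      simpa [mul_div_cancel₀, hc] using this)
  exact ⟨g, hg, fun a b c => by rw [hgz, hψ]⟩

variable [DecidableEq K]

theorem card_filter_linear_le {l m : K} (r : K) (hlm : l ≠ 0 ∨ m ≠ 0) :
    (Finset.univ.filter fun x : K × K => l * x.1 + m * x.2 + r = 0).card ≤ Fintype.card K := by
  rw [← Finset.card_univ]
  rcases hlm with h | h
  · refine Finset.card_le_card_of_injOn Prod.snd (by simp) ?_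
    rintro ⟨a, b⟩ h₁ ⟨a', b'⟩ h₂ (rfl : b = b')
    simp only [Finset.coe_filter, Finset.mem_univ, true_and, Set.mem_ofPred_eq] at h₁ h₂
    rw [mul_left_cancel₀ h (show l * a = l * a' by linear_combination h₁ - h₂)]
  · refine Finset.card_le_card_of_injOn Prod.fst (by simp) ?_
    rintro ⟨a, b⟩ h₁ ⟨a', b'⟩ h₂ (rfl : a = a')
    simp only [Finset.coe_filter, Finset.mem_univ, true_and, Set.mem_ofPred_eq] at h₁ h₂
    rw [mul_left_cancel₀ h (show m * b = m * b' by linear_combination h₁ - h₂)]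

/-- The number of zeros on a line is at most the degree, unless all points are zeros. -/
theorem IsForm.card_filter_line_le {V : Type} [AddCommGroup V] [Module K V] {e : ℕ} {h : V → K}
    (hh : IsForm e h) {x y : V} (hne : ∃ t : K, h (x + t • y) ≠ 0) :
    (Finset.univ.filter fun t : K => h (x + t • y) = 0).card ≤ e := by
  obtain ⟨p, hp₁, -, hp₃⟩ := hh.exists_line x y
  obtain ⟨t, ht⟩ := hne
  have hp : p ≠ 0 := by
    rintro rfl
    simp [← hp₃] at ht
  simp only [← hp₃]
  exact (Polynomial.card_filter_eval_le hp).trans hp₁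

theorem card_zeros_le {e : ℕ} (h : K × K × K → K) (hh : IsForm e h)
    (he : e < Fintype.card K) (hne : ∃ a b, h (a, b, 1) ≠ 0) :
    (Finset.univ.filter fun x : K × K => h (x.1, x.2, 1) = 0).card ≤ e * Fintype.card K := by
  induction e generalizing h with
  | zero =>
    obtain ⟨a, b, hab⟩ := hne
    rw [Finset.filter_false_of_mem, Finset.card_empty, zero_mul]
    rintro ⟨a', b'⟩ -
    have h1 := hh.map_smul 0 (a, b, 1)
    have h2 := hh.map_smul 0 (a', b', 1)
    simp at h1 h2
    rwa [← h2, h1]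
  | succ e ih =>
    by_cases hl : ∃ b, ∀ a, h (a, b, 1) = 0
    · obtain ⟨b₀, hb₀⟩ := hl
      obtain ⟨g, hg, hgh⟩ := exists_eq_linear_mul hh he (l := 0) (m := 1) (r := -b₀) (by simp)
        (fun a b hab => by
          obtain rfl : b = b₀ := by linear_combination hab
          exact hb₀ a)
      have hsub : (Finset.univ.filter fun x : K × K => h (x.1, x.2, 1) = 0) ⊆
          (Finset.univ.filter fun x : K × K => 0 * x.1 + 1 * x.2 + -b₀ = 0) ∪
          (Finset.univ.filter fun x : K × K => g (x.1, x.2, 1) = 0) := by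
        rintro ⟨a, b⟩ hx
        simpa [hgh] using hx
      refine (Finset.card_le_card hsub).trans ((Finset.card_union_le _ _).trans ?_)
      have h1 := card_filter_linear_le (l := (0 : K)) (m := 1) (-b₀) (by simp)
      have h2 := ih g hg (by omega) (by
        obtain ⟨a, b, hab⟩ := hne
        exact ⟨a, b, fun h0 => hab (by rw [hgh, h0, mul_zero])⟩)
      linarith
    · push Not at hl
      rw [← Finset.card_univ (α := K)]
      refine Finset.card_le_mul_card_image_of_maps_to (f := Prod.snd)
        (t := (Finset.univ : Finset K)) (fun _ _ => Finset.mem_univ _) _ fun b _ => ?_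
      refine le_trans ?_ (hh.card_filter_line_le (x := (0, b, 1)) (y := (1, 0, 0))
        (by simpa using hl b))
      refine Finset.card_le_card_of_injOn Prod.fst ?_ ?_
      · rintro ⟨a, b'⟩ hx
        simp at hx
        obtain ⟨h1, rfl⟩ := hx
        simpa using h1
      · rintro ⟨a, b₁⟩ h₁ ⟨a', b₂⟩ h₂ (rfl : a = a')
        simp at h₁ h₂
        rw [h₁.2, h₂.2]

/-- A plane curve with as many affine zeros as possible contains a line. -/
theorem exists_line_of_card_zeros {e : ℕ} {h : K × K × K → K} (hh : IsForm (e + 1) h)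
    (he : e + 1 < Fintype.card K)
    (hcard : (e + 1) * Fintype.card K ≤
      (Finset.univ.filter fun x : K × K => h (x.1, x.2, 1) = 0).card) :
    ∃ l m r : K, (l ≠ 0 ∨ m ≠ 0) ∧ ∀ a b, l * a + m * b + r = 0 → h (a, b, 1) = 0 := by
  set Z := Finset.univ.filter fun x : K × K => h (x.1, x.2, 1) = 0 with hZ
  have hq : 0 < Fintype.card K := Fintype.card_pos
  obtain ⟨⟨a₀, b₀⟩, h₀⟩ : Z.Nonempty := by
    rw [← Finset.card_pos]
    exact lt_of_lt_of_le (by positivity) hcard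
  have h₀' : h (a₀, b₀, 1) = 0 := by simpa [hZ] using h₀
  by_cases hl : ∃ v : K × K, v ≠ 0 ∧ ∀ t : K, h (a₀ + t * v.1, b₀ + t * v.2, 1) = 0
  · obtain ⟨⟨v, w⟩, hv, hvz⟩ := hl
    refine ⟨w, -v, v * b₀ - w * a₀, ?_, fun a b hab => ?_⟩
    · by_contra! hc
      exact hv (by ext <;> simp_all)
    · by_cases hw : w = 0
      · have hv' : v ≠ 0 := by rintro rfl; simp [hw] at hv
        subst hw
        obtain rfl : b = b₀ := mul_left_cancel₀ hv' (by linear_combination -hab)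
        simpa [hv'] using hvz ((a - a₀) / v)
      · have := hvz ((b - b₀) / w)
        rwa [show a₀ + (b - b₀) / w * v = a by field_simp; linear_combination -hab,
          show b₀ + (b - b₀) / w * w = b by field_simp; ring] at this
  · exfalso
    push Not at hl
    have key : ∀ t ∈ (Finset.univ : Finset K).erase 0,
        (Finset.univ.filter fun v : K × K => h (a₀ + t * v.1, b₀ + t * v.2, 1) = 0).card =
          Z.card := by
      intro t ht
      have ht : t ≠ 0 := by simpa using ht
      refine Finset.card_bij' (fun v _ => (a₀ + t * v.1, b₀ + t * v.2))
        (fun v _ => ((v.1 - a₀) / t, (v.2 - b₀) / t)) ?_ ?_ ?_ ?_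
      · intro v hv
        simpa [hZ] using hv
      · intro v hv
        have : h (v.1, v.2, 1) = 0 := by simpa [hZ] using hv
        simp [mul_div_cancel₀, ht, this]
      · rintro ⟨a, b⟩ -
        simp [ht]
      · rintro ⟨a, b⟩ -
        simp [mul_div_cancel₀, ht]
    have hsum : ∑ v : K × K,
        (Finset.univ.filter fun t : K => h (a₀ + t * v.1, b₀ + t * v.2, 1) = 0).card =
        ∑ t : K,
        (Finset.univ.filter fun v : K × K => h (a₀ + t * v.1, b₀ + t * v.2, 1) = 0).card := by
      simp only [Finset.card_filter]
      exact Finset.sum_comm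
    have hle : ∑ v : K × K,
        (Finset.univ.filter fun t : K => h (a₀ + t * v.1, b₀ + t * v.2, 1) = 0).card ≤
        Fintype.card K + (Fintype.card K ^ 2 - 1) * (e + 1) := by
      rw [← Finset.add_sum_erase _ _ (Finset.mem_univ (0 : K × K))]
      refine add_le_add (Finset.card_le_univ _) ?_
      refine (Finset.sum_le_card_nsmul _ _ (e + 1) fun v hv => ?_).trans (le_of_eq ?_)
      · have := hl v (by simpa using hv)
        simpa using hh.card_filter_line_le (x := (a₀, b₀, 1)) (y := (v.1, v.2, 0))
          (by simpa using this)
      · rw [Finset.card_erase_of_mem (Finset.mem_univ _), Finset.card_univ, Fintype.card_prod,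
          smul_eq_mul, sq]
    rw [hsum, ← Finset.add_sum_erase _ _ (Finset.mem_univ (0 : K)), Finset.sum_congr rfl key,
      Finset.sum_const, Finset.card_erase_of_mem (Finset.mem_univ _), Finset.card_univ] at hle
    simp only [zero_mul, add_zero, h₀', Finset.filter_true, Finset.card_univ, Fintype.card_prod,
      smul_eq_mul] at hle
    generalize Fintype.card K = q at *
    obtain ⟨k, rfl⟩ : ∃ k, q = k + e + 2 := ⟨q - e - 2, by omega⟩
    obtain ⟨z, hz⟩ := Nat.exists_eq_add_of_le hcard
    rw [hz] at hle
    zify at hle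
    rw [Nat.cast_sub (by omega), Nat.cast_sub (Nat.one_le_pow _ _ (by omega))] at hle
    push_cast at hle
    have h1 : (0 : ℤ) ≤ k := by positivity
    have h2 : (0 : ℤ) ≤ e := by positivity
    have h3 : (0 : ℤ) ≤ z := by positivity
    have : ((k : ℤ) + e + 1) * (((e + 1) * (k + e + 2) + z) ) + (k + e + 2) * (k + e + 2) ≤
      k + e + 2 + ((k + e + 2) ^ 2 - 1) * (e + 1) := by linarith
    nlinarith [mul_nonneg h1 h2, mul_nonneg h1 h3, mul_nonneg h2 h3, mul_nonneg h1 h1]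

/-- A plane curve with as many affine zeros as possible is a union of parallel lines. -/
theorem exists_parallel_lines {e : ℕ} (h : K × K × K → K) (hh : IsForm e h)
    (he : e < Fintype.card K) (hne : ∃ a b, h (a, b, 1) ≠ 0)
    (hcard : e * Fintype.card K ≤
      (Finset.univ.filter fun x : K × K => h (x.1, x.2, 1) = 0).card) :
    ∃ (k l m : K) (T : Finset K), k ≠ 0 ∧ (l ≠ 0 ∨ m ≠ 0) ∧ T.card = e ∧
      ∀ a b c, h (a, b, c) = k * ∏ τ ∈ T, (l * a + m * b + τ * c) := by
  induction e generalizing h with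
  | zero =>
    obtain ⟨a, b, hab⟩ := hne
    refine ⟨h (a, b, 1), 1, 0, ∅, hab, by simp, by simp, fun a' b' c' => ?_⟩
    have h1 := hh.map_smul 0 (a, b, 1)
    have h2 := hh.map_smul 0 (a', b', c')
    simp at h1 h2
    simp [← h2, h1]
  | succ e ih =>
    obtain ⟨l, m, r, hlm, hz⟩ := exists_line_of_card_zeros hh he hcard
    obtain ⟨g, hg, hgh⟩ := exists_eq_linear_mul hh he hlm hz
    have hgne : ∃ a b, g (a, b, 1) ≠ 0 := by
      obtain ⟨a, b, hab⟩ := hne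
      exact ⟨a, b, fun h0 => hab (by rw [hgh, h0, mul_zero])⟩
    have hU : (Finset.univ.filter fun x : K × K => h (x.1, x.2, 1) = 0) =
        (Finset.univ.filter fun x : K × K => l * x.1 + m * x.2 + r = 0) ∪
        (Finset.univ.filter fun x : K × K => g (x.1, x.2, 1) = 0) := by
      ext ⟨a, b⟩
      simp [hgh]
    have h1 := card_filter_linear_le r hlm
    have h2 := card_zeros_le g hg (by omega) hgne
    have h3 := Finset.card_union_add_card_inter
      (Finset.univ.filter fun x : K × K => l * x.1 + m * x.2 + r = 0)
      (Finset.univ.filter fun x : K × K => g (x.1, x.2, 1) = 0)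
    rw [hU, add_mul, one_mul] at hcard
    have hdisj : ∀ a b, l * a + m * b + r = 0 → g (a, b, 1) ≠ 0 := by
      intro a b h4 h5
      have : (a, b) ∈ (Finset.univ.filter fun x : K × K => l * x.1 + m * x.2 + r = 0) ∩
        (Finset.univ.filter fun x : K × K => g (x.1, x.2, 1) = 0) := by simp [h4, h5]
      have := Finset.card_pos.2 ⟨_, this⟩
      omega
    obtain ⟨k, l', m', T, hk, hlm', hT, hgT⟩ := ih g hg (by omega) hgne (by omega)
    rcases T.eq_empty_or_nonempty with rfl | ⟨τ, hτ⟩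
    · refine ⟨k, l, m, {r}, hk, hlm, by simp [← hT], fun a b c => ?_⟩
      simp [hgh, hgT, mul_comm]
    have hdet : l * m' = m * l' := by
      by_contra hd
      have hd' : l * m' - m * l' ≠ 0 := sub_ne_zero.2 hd
      refine hdisj ((m * τ - r * m') / (l * m' - m * l')) ((r * l' - l * τ) / (l * m' - m * l'))
        (by field_simp; ring) ?_
      rw [hgT, Finset.prod_eq_zero hτ, mul_zero]
      linear_combination (-τ) * inv_mul_cancel₀ hd'
    obtain ⟨s, hs, rfl, rfl⟩ : ∃ s, s ≠ 0 ∧ l = s * l' ∧ m = s * m' := by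
      by_cases hl' : l' = 0
      · subst hl'
        have hm' : m' ≠ 0 := by tauto
        have hl : l = 0 := by simpa [hm'] using hdet
        have hm : m ≠ 0 := by tauto
        exact ⟨m / m', div_ne_zero hm hm', by simp [hl], by field_simp⟩
      · have hl : l ≠ 0 := by
          rintro rfl
          simp [hl'] at hdet
          tauto
        exact ⟨l / l', div_ne_zero hl hl', by field_simp, by field_simp; linear_combination -hdet⟩
    have hr : r / s ∉ T := by
      intro hrT
      obtain ⟨a, b, hab⟩ : ∃ a b, l' * a + m' * b + r / s = 0 := by
        rcases hlm' with h | h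
        · exact ⟨-(r / s) / l', 0, by field_simp; ring⟩
        · exact ⟨0, -(r / s) / m', by field_simp; ring⟩
      refine hdisj a b ?_ ?_
      · field_simp at hab
        linear_combination hab
      · rw [hgT, Finset.prod_eq_zero hrT (by linear_combination hab), mul_zero]
    refine ⟨s * k, l', m', insert (r / s) T, mul_ne_zero hs hk, hlm', by
      rw [Finset.card_insert_of_notMem hr, hT], fun a b c => ?_⟩
    rw [Finset.prod_insert hr, hgh, hgT]
    field_simp

end Plane

section Geometry

variable {V : Type} [AddCommGroup V] [Module K V]

/-- `D x y` is the derivative of the form `f` of degree `m + 1` at `x` in direction `y`. -/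
structure IsPolar (m : ℕ) (f : V → K) (D : V → V →ₗ[K] K) : Prop where
  isForm : ∀ y, IsForm m fun x => D x y
  self : ∀ x, D x x = ((m + 1 : ℕ) : K) * f x
  line : ∀ x y, ∃ p : Polynomial K, p.natDegree ≤ m + 1 ∧ p.coeff (m + 1) = f y ∧
    p.coeff 1 = D x y ∧ ∀ t, p.eval t = f (x + t • y)

theorem IsPolar.map_smul {m : ℕ} {f : V → K} {D : V → V →ₗ[K] K} (hD : IsPolar m f D) (c : K)
    (x : V) : D (c • x) = c ^ m • D x :=
  LinearMap.ext fun y => (hD.isForm y).map_smul c x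

theorem IsForm.exists_isPolar {m : ℕ} {f : V → K} (hf : IsForm (m + 1) f) :
    ∃ D, IsPolar m f D := by
  obtain ⟨D, ⟨-, h₁⟩, h₂, h₃⟩ := hf.exists_polar_aux
  exact ⟨D, h₁ m rfl, h₂, h₃⟩

/-- The form `f` vanishes on the span of `x` and `y`. -/
def VanishesOnLine (f : V → K) (x y : V) : Prop := ∀ a b : K, f (a • x + b • y) = 0

theorem VanishesOnLine.symm {f : V → K} {x y : V} (h : VanishesOnLine f x y) :
    VanishesOnLine f y x := fun a b => by rw [add_comm]; exact h b a

theorem VanishesOnLine.left {f : V → K} {x y : V} (h : VanishesOnLine f x y) : f x = 0 := by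
  simpa using h 1 0

theorem VanishesOnLine.right {f : V → K} {x y : V} (h : VanishesOnLine f x y) : f y = 0 :=
  h.symm.left

theorem VanishesOnLine.comb {f : V → K} {x y : V} (h : VanishesOnLine f x y) (a b c d : K) :
    VanishesOnLine f (a • x + b • y) (c • x + d • y) := fun s t => by
  convert h (s * a + t * c) (s * b + t * d) using 2
  module

variable [Fintype K] [Fintype V] [DecidableEq K]

/-- A form of degree `m + 1` in four variables over a field with `q` elements that vanishes on
no plane and has `m * q ^ 3 + q ^ 2 - m * q` zeros. -/
structure IsExtremalForm (m : ℕ) (f : V → K) : Prop where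
  isForm : IsForm (m + 1) f
  one_le : 1 ≤ m
  lt : m < Fintype.card K
  finrank_eq : Module.finrank K V = 4
  exists_ne : ∀ x y z : V, LinearIndependent K ![x, y, z] →
    ∃ a b c : K, f (a • x + b • y + c • z) ≠ 0
  card_zeros : (Finset.univ.filter fun x => f x = 0).card + m * Fintype.card K =
    m * Fintype.card K ^ 3 + Fintype.card K ^ 2

omit [Fintype K] [Module K V] in
theorem sum_card_translate {ι : Type} [Fintype ι] (f : V → K) (φ : ι → V) :
    ∑ x, (Finset.univ.filter fun i => f (x + φ i) = 0).card =
      Fintype.card ι * (Finset.univ.filter fun x => f x = 0).card := by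
  simp only [Finset.card_filter]
  rw [Finset.sum_comm, ← smul_eq_mul, ← Finset.card_univ, ← Finset.sum_const]
  refine Finset.sum_congr rfl fun i _ => ?_
  exact Equiv.sum_comp (Equiv.addRight (φ i)) fun x => if f x = 0 then 1 else 0

omit [DecidableEq K] in
open Classical in
theorem sum_ite_mem_submodule (W : Submodule K V) (a b : ℕ) :
    ∑ x : V, (if x ∈ W then a else b) + Fintype.card K ^ Module.finrank K W * b =
      Fintype.card K ^ Module.finrank K W * a + Fintype.card K ^ Module.finrank K V * b := by
  have h1 : (Finset.univ.filter fun x => x ∈ W).card = Fintype.card K ^ Module.finrank K W := by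
    rw [← Module.card_eq_pow_finrank (K := K) (V := W), Fintype.card_subtype]
  have h2 := Finset.card_filter_add_card_filter_not (s := (Finset.univ : Finset V)) (fun x => x ∈ W)
  rw [h1, Finset.card_univ, Module.card_eq_pow_finrank (K := K) (V := V)] at h2
  rw [Finset.sum_ite, Finset.sum_const, Finset.sum_const, smul_eq_mul, smul_eq_mul, h1, ← h2]
  ring

namespace IsExtremalForm

variable {m : ℕ} {f : V → K}

/-- Through every zero there is a line of zeros. -/
theorem exists_vanishesOnLine (hf : IsExtremalForm m f) {P : V} (hP : P ≠ 0) (hfP : f P = 0) :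
    ∃ Q, LinearIndependent K ![P, Q] ∧ VanishesOnLine f P Q := by
  classical
  by_contra! hc
  have key : ∀ x : V, (Finset.univ.filter fun t : K => f (x + t • P) = 0).card ≤
      if x ∈ Submodule.span K {P} then Fintype.card K else m := by
    intro x
    split_ifs with hx
    · exact Finset.card_le_univ _
    · obtain ⟨p, hp₁, hp₂, hp₃⟩ := hf.isForm.exists_line x P
      have hp : p ≠ 0 := by
        rintro rfl
        refine hc x ?_ fun a b => ?_
        · rw [LinearIndependent.pair_iff' hP]
          rintro a rfl
          exact hx (Submodule.smul_mem _ _ (Submodule.mem_span_singleton_self P))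
        · by_cases hb : b = 0
          · simp [hb, hf.isForm.map_smul, hfP]
          · rw [show a • P + b • x = b • (x + (a / b) • P) by
              rw [smul_add, smul_smul, mul_div_cancel₀ _ hb, add_comm],
              hf.isForm.map_smul, ← hp₃, Polynomial.eval_zero, mul_zero]
      simp only [← hp₃]
      refine (Polynomial.card_filter_eval_le hp).trans ?_
      by_contra! hlt
      have : p.natDegree = m + 1 := by omega
      exact hp (Polynomial.leadingCoeff_eq_zero.1 (by
        rw [Polynomial.leadingCoeff, this, hp₂, hfP]))
  have h1 := Finset.sum_le_sum fun x (_ : x ∈ Finset.univ) => key x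
  rw [sum_card_translate f fun t : K => t • P] at h1
  have h2 := sum_ite_mem_submodule (Submodule.span K {P}) (Fintype.card K) m
  rw [finrank_span_singleton hP, hf.finrank_eq] at h2
  have h3 := hf.card_zeros
  have h4 := hf.lt
  have h5 := hf.one_le
  generalize Fintype.card K = q at *
  have h6 : (q : ℕ) ^ 3 + q * m ≤ q ^ 2 + m * q ^ 2 := by nlinarith
  obtain ⟨k, rfl⟩ := Nat.exists_eq_add_of_lt h4
  nlinarith [Nat.zero_le (k * m), Nat.zero_le (k ^ 2 * m), Nat.zero_le (k * m ^ 2),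
    Nat.zero_le (k ^ 2)]

omit [Fintype K] [Fintype V] [DecidableEq K] in
theorem linearIndependent_of_notMem {P Q w : V} (h : LinearIndependent K ![P, Q])
    (hw : w ∉ Submodule.span K {P, Q}) : LinearIndependent K ![w, P, Q] := by
  rw [show ![w, P, Q] = Fin.cons w ![P, Q] from rfl, linearIndependent_finCons]
  refine ⟨h, ?_⟩
  rwa [Matrix.range_cons, Matrix.range_cons, Matrix.range_empty, Set.union_empty,
    Set.singleton_union]

/-- A plane through a line of zeros meets the surface in `m + 1` lines with a common point. -/
theorem exists_pencil (hf : IsExtremalForm m f) {P Q : V} (hPQ : LinearIndependent K ![P, Q])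
    (hl : VanishesOnLine f P Q) {w : V} (hw : w ∉ Submodule.span K {P, Q}) :
    ∃ (k l μ : K) (T : Finset K), k ≠ 0 ∧ (l ≠ 0 ∨ μ ≠ 0) ∧ T.card = m ∧
      ∀ a b c, f (a • P + b • Q + c • w) = c * (k * ∏ τ ∈ T, (l * a + μ * b + τ * c)) := by
  classical
  have hex : ∀ w ∉ Submodule.span K {P, Q}, ∃ h : K × K × K → K, IsForm m h ∧
      (∃ a b, h (a, b, 1) ≠ 0) ∧ ∀ a b c, f (a • P + b • Q + c • w) = c * h (a, b, c) := by
    intro w hw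
    let φ : K × K × K →ₗ[K] V := (LinearMap.toSpanSingleton K V P).coprod
      ((LinearMap.toSpanSingleton K V Q).coprod (LinearMap.toSpanSingleton K V w))
    have hφ : ∀ a b c, φ (a, b, c) = a • P + b • Q + c • w := fun a b c => by
      simp [φ, add_assoc]
    let ψ : K × K × K →ₗ[K] K := LinearMap.snd K K K ∘ₗ LinearMap.snd K K (K × K)
    have hψ0 : ψ ≠ 0 := by
      intro h0
      simpa [ψ] using congrArg (fun g => g (0, 0, 1)) h0
    obtain ⟨h, hh, hfh⟩ := (hf.isForm.comp φ).exists_eq_mul hψ0 (by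
      rintro ⟨a, b, c⟩ (rfl : c = 0)
      simpa [hφ] using hl a b)
    have hfh' : ∀ a b c, f (a • P + b • Q + c • w) = c * h (a, b, c) := fun a b c => by
      rw [← hφ, hfh]; rfl
    refine ⟨h, hh, ?_, hfh'⟩
    by_contra! hc
    obtain ⟨c, a, b, habc⟩ := hf.exists_ne w P Q (linearIndependent_of_notMem hPQ hw)
    rw [show c • w + a • P + b • Q = a • P + b • Q + c • w by abel, hfh'] at habc
    by_cases h0 : c = 0
    · simp [h0] at habc
    · have := hh.map_smul c (a / c, b / c, 1)
      simp only [Prod.smul_mk, smul_eq_mul, mul_div_cancel₀ _ h0, mul_one, hc, mul_zero] at this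
      simp [this] at habc
  have key : ∀ w : V, (Finset.univ.filter fun t : K × K =>
      f (w + (t.1 • P + t.2 • Q)) = 0).card ≤
      if w ∈ Submodule.span K {P, Q} then Fintype.card K ^ 2 else m * Fintype.card K := by
    intro w
    split_ifs with hw
    · exact (Finset.card_le_univ _).trans (by simp [sq])
    · obtain ⟨h, hh, hne, hfh⟩ := hex w hw
      convert card_zeros_le h hh hf.lt hne using 3 with t
      have := hfh t.1 t.2 1
      rw [one_smul, one_mul] at this
      rw [add_comm, this]
  have h1 := sum_card_translate f fun t : K × K => t.1 • P + t.2 • Q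
  have h2 := sum_ite_mem_submodule (Submodule.span K {P, Q}) (Fintype.card K ^ 2)
    (m * Fintype.card K)
  have h3 : Module.finrank K (Submodule.span K {P, Q}) = 2 := by
    have := finrank_span_eq_card hPQ
    rwa [Matrix.range_cons, Matrix.range_cons, Matrix.range_empty, Set.union_empty,
      Set.singleton_union] at this
  rw [h3, hf.finrank_eq] at h2
  have hcz := hf.card_zeros
  have hw' : m * Fintype.card K ≤ (Finset.univ.filter fun t : K × K =>
      f (w + (t.1 • P + t.2 • Q)) = 0).card := by
    by_contra! hlt
    have := Finset.sum_lt_sum (fun x (_ : x ∈ Finset.univ) => key x)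
      ⟨w, Finset.mem_univ w, by rwa [if_neg hw]⟩
    rw [h1, Fintype.card_prod] at this
    nlinarith
  obtain ⟨h, hh, hne, hfh⟩ := hex w hw
  obtain ⟨k, l, μ, T, hk, hlμ, hT, hhT⟩ := exists_parallel_lines h hh hf.lt hne (by
    convert hw' using 3 with t
    have := hfh t.1 t.2 1
    rw [one_smul, one_mul] at this
    rw [add_comm w, this])
  exact ⟨k, l, μ, T, hk, hlμ, hT, fun a b c => by rw [hfh, hhT]⟩

end IsExtremalForm

end Geometry

section Quadrangle

variable {V : Type} [AddCommGroup V] [Module K V] [Fintype K] [Fintype V] [DecidableEq K]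
  {m : ℕ} {f : V → K} {D : V → V →ₗ[K] K}

namespace IsExtremalForm

theorem exists_pencil_polar (hf : IsExtremalForm m f) (hD : IsPolar m f D) {P Q : V}
    (hPQ : LinearIndependent K ![P, Q]) (hl : VanishesOnLine f P Q) {w : V}
    (hw : w ∉ Submodule.span K {P, Q}) :
    ∃ (k l μ : K) (T : Finset K), k ≠ 0 ∧ (l ≠ 0 ∨ μ ≠ 0) ∧ T.card = m ∧
      (∀ a b c, f (a • P + b • Q + c • w) = c * (k * ∏ τ ∈ T, (l * a + μ * b + τ * c))) ∧
      ∀ a b, D (a • P + b • Q) w = k * (l * a + μ * b) ^ m := by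
  obtain ⟨k, l, μ, T, hk, hlμ, hT, h⟩ := hf.exists_pencil hPQ hl hw
  refine ⟨k, l, μ, T, hk, hlμ, hT, h, fun a b => ?_⟩
  obtain ⟨p, hp₁, hp₂, hp₃, hp₄⟩ := hD.line (a • P + b • Q) w
  let s : Polynomial K := ∏ τ ∈ T, (Polynomial.C τ * Polynomial.X + Polynomial.C (l * a + μ * b))
  have hs₁ : s.natDegree ≤ m := by
    refine (Polynomial.natDegree_prod_le _ _).trans ?_
    rw [← hT, Finset.card_eq_sum_ones]
    exact Finset.sum_le_sum fun τ _ => Polynomial.natDegree_linear_le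
  have hs₂ : s.coeff m = ∏ τ ∈ T, τ := by
    have := Polynomial.coeff_prod_of_natDegree_le T
      (fun τ => Polynomial.C τ * Polynomial.X + Polynomial.C (l * a + μ * b)) 1
      fun τ _ => Polynomial.natDegree_linear_le
    rw [mul_one, hT] at this
    rw [this]
    exact Finset.prod_congr rfl fun τ _ => by simp [Polynomial.coeff_C]
  have hs₃ : ∀ t, s.eval t = ∏ τ ∈ T, (l * a + μ * b + τ * t) := fun t => by
    simp only [s, Polynomial.eval_prod]
    exact Finset.prod_congr rfl fun τ _ => by simp; ring
  have hfw : f w = k * ∏ τ ∈ T, τ := by simpa using h 0 0 1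
  have hr₀ : p - Polynomial.C k * s * Polynomial.X = 0 := by
    refine Polynomial.eq_zero_of_forall_eval (lt_of_le_of_lt ?_ hf.lt) fun t => ?_
    · rw [Polynomial.natDegree_le_iff_coeff_eq_zero]
      intro N hN
      obtain ⟨N, rfl⟩ : ∃ n, N = n + 1 := ⟨N - 1, by omega⟩
      rw [Polynomial.coeff_sub, Polynomial.coeff_mul_X, Polynomial.coeff_C_mul]
      rcases (show m ≤ N by omega).eq_or_lt with rfl | hlt
      · rw [hp₂, hs₂, hfw, sub_self]
      · rw [Polynomial.coeff_eq_zero_of_natDegree_lt (by omega),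
          Polynomial.coeff_eq_zero_of_natDegree_lt (by omega), mul_zero, sub_zero]
    · simp only [Polynomial.eval_sub, Polynomial.eval_mul, Polynomial.eval_C, Polynomial.eval_X,
        hp₄, hs₃, h]
      ring
  rw [← hp₃, sub_eq_zero.1 hr₀, show (1 : ℕ) = 0 + 1 from rfl, Polynomial.coeff_mul_X,
    Polynomial.coeff_C_mul, Polynomial.coeff_zero_eq_eval_zero, hs₃]
  simp [hT]

theorem polar_eq_zero (hf : IsExtremalForm m f) (hD : IsPolar m f D) {x y : V}
    (h : VanishesOnLine f x y) : D x y = 0 := by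
  obtain ⟨p, hp₁, hp₂, hp₃, hp₄⟩ := hD.line x y
  rw [h.right] at hp₂
  have hp : p = 0 := by
    refine Polynomial.eq_zero_of_forall_eval (lt_of_le_of_lt ?_ hf.lt) fun t => ?_
    · rw [Polynomial.natDegree_le_iff_coeff_eq_zero]
      intro N hN
      rcases (show m + 1 ≤ N from hN).eq_or_lt with rfl | hlt
      · exact hp₂
      · exact Polynomial.coeff_eq_zero_of_natDegree_lt (by omega)
    · simpa [hp₄] using h 1 t
  simp [← hp₃, hp]

theorem polar_self (hf : IsExtremalForm m f) (hD : IsPolar m f D) {x : V} (h : f x = 0) :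
    D x x = 0 := hf.polar_eq_zero hD fun a b => by
  rw [← add_smul, hf.isForm.map_smul, h, mul_zero]

theorem exists_notMem_span (hf : IsExtremalForm m f) (ψ : V →ₗ[K] K) (P Q : V) :
    ∃ w ∉ Submodule.span K {P, Q}, ψ w = 0 := by
  classical
  by_contra! hc
  have hle : LinearMap.ker ψ ≤ Submodule.span K {P, Q} := fun w hw => by
    by_contra h
    exact hc w h hw
  have h1 := Submodule.finrank_mono hle
  have h2 := ψ.finrank_range_add_finrank_ker
  have h3 : Module.finrank K (LinearMap.range ψ) ≤ 1 := by
    simpa using Submodule.finrank_le (LinearMap.range ψ)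
  have h4 := finrank_span_finset_le_card (R := K) ({P, Q} : Finset V)
  have h5 : (({P, Q} : Finset V)).card ≤ 2 := Finset.card_le_two
  have h6 := hf.finrank_eq
  rw [Finset.coe_insert, Finset.coe_singleton, Set.finrank] at h4
  omega

omit [Fintype K] [Fintype V] [DecidableEq K] in
theorem linearIndependent_symm {P Q : V} (h : LinearIndependent K ![P, Q]) :
    LinearIndependent K ![Q, P] := by
  rw [LinearIndependent.pair_iff] at h ⊢
  intro s t hst
  exact (h t s (by rwa [add_comm])).symm

/-- The zeros in the tangent plane at `P` are joined to `P` by lines of zeros. -/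
theorem vanishesOnLine_of_polar_eq_zero (hf : IsExtremalForm m f) (hD : IsPolar m f D) {P R : V}
    (hP : P ≠ 0) (hfP : f P = 0) (hfR : f R = 0) (h0 : D P R = 0) : VanishesOnLine f P R := by
  obtain ⟨Q, hPQ, hl⟩ := hf.exists_vanishesOnLine hP hfP
  by_cases hR : R ∈ Submodule.span K {P, Q}
  · obtain ⟨a, b, rfl⟩ := Submodule.mem_span_pair.1 hR
    simpa using hl.comb 1 0 a b
  obtain ⟨k, l, μ, T, hk, hlμ, hT, h, hp⟩ := hf.exists_pencil_polar hD hPQ hl hR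
  have hm : m ≠ 0 := by have := hf.one_le; omega
  obtain rfl : l = 0 := by
    have := hp 1 0
    simpa [h0, hk, hm] using this.symm
  intro a c
  have h1 := h 0 0 1
  have h2 := h a 0 c
  simp only [zero_smul, one_smul, zero_add, hfR, mul_zero, mul_one, one_mul, zero_mul,
    add_zero] at h1 h2
  rw [h2, Finset.prod_mul_distrib]
  linear_combination (-c * ∏ τ ∈ T, c) * h1

theorem polar_symm (hf : IsExtremalForm m f) (hD : IsPolar m f D) {P R : V}
    (hP : P ≠ 0) (hfP : f P = 0) (hfR : f R = 0) (h0 : D P R = 0) : D R P = 0 :=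
  hf.polar_eq_zero hD (hf.vanishesOnLine_of_polar_eq_zero hD hP hfP hfR h0).symm

/-- Given a line of zeros through `P` and `Q`, there is a second one through `P`. -/
theorem exists_second_line (hf : IsExtremalForm m f) (hD : IsPolar m f D) {P Q : V}
    (hPQ : LinearIndependent K ![P, Q]) (hl : VanishesOnLine f P Q) :
    ∃ R, f R = 0 ∧ D P R = 0 ∧ D Q R ≠ 0 := by
  obtain ⟨w, hw, hPw⟩ := hf.exists_notMem_span (D P) P Q
  obtain ⟨k, l, μ, T, hk, hlμ, hT, h, hp⟩ := hf.exists_pencil_polar hD hPQ hl hw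
  have hm : m ≠ 0 := by have := hf.one_le; omega
  obtain rfl : l = 0 := by
    have := hp 1 0
    simpa [hPw, hk, hm] using this.symm
  have hμ : μ ≠ 0 := by tauto
  obtain ⟨τ, hτ⟩ : T.Nonempty := by
    rw [← Finset.card_pos, hT]
    exact hf.one_le
  refine ⟨(-τ / μ) • Q + w, ?_, ?_, ?_⟩
  · have := h 0 (-τ / μ) 1
    rw [Finset.prod_eq_zero hτ (by field_simp; ring)] at this
    simpa using this
  · rw [map_add, map_smul, hf.polar_eq_zero hD hl, hPw]
    simp
  · have := hp 0 1
    rw [map_add, map_smul, hf.polar_self hD hl.right]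
    simp at this
    simp [this, hk, hμ]

/-- Every line of zeros is a side of a quadrilateral of lines of zeros. -/
theorem exists_quadrilateral (hf : IsExtremalForm m f) (hD : IsPolar m f D) {P Q : V}
    (hPQ : LinearIndependent K ![P, Q]) (hl : VanishesOnLine f P Q) :
    ∃ R S, VanishesOnLine f P S ∧ VanishesOnLine f R Q ∧ VanishesOnLine f R S ∧
      D P R ≠ 0 ∧ D Q S ≠ 0 ∧ D R P ≠ 0 ∧ D S Q ≠ 0 := by
  have hP : P ≠ 0 := hPQ.ne_zero 0
  have hQ : Q ≠ 0 := hPQ.ne_zero 1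
  obtain ⟨R, hfR, hQR, hPR⟩ := hf.exists_second_line hD (linearIndependent_symm hPQ) hl.symm
  obtain ⟨S, hfS, hPS, hQS⟩ := hf.exists_second_line hD hPQ hl
  have hR : R ≠ 0 := by rintro rfl; simp at hPR
  have hRP : D R P ≠ 0 := fun h => hPR (hf.polar_symm hD hR hfR hl.left h)
  have hlPS := hf.vanishesOnLine_of_polar_eq_zero hD hP hl.left hfS hPS
  have hlQR := hf.vanishesOnLine_of_polar_eq_zero hD hQ hl.right hfR hQR
  have hlPS' := hlPS.comb 1 0 (-(D R S) / D R P) 1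
  simp only [one_smul, zero_smul, add_zero] at hlPS'
  have hQS' : D Q ((-(D R S) / D R P) • P + S) ≠ 0 := by
    rw [map_add, map_smul, hf.polar_eq_zero hD hl.symm]
    simpa using hQS
  have hS' : (-(D R S) / D R P) • P + S ≠ 0 := by
    intro h
    simp [h] at hQS'
  refine ⟨R, (-(D R S) / D R P) • P + S, hlPS', hlQR.symm, ?_, hPR, hQS', hRP, ?_⟩
  · refine hf.vanishesOnLine_of_polar_eq_zero hD hR hfR hlPS'.right ?_
    rw [map_add, map_smul, smul_eq_mul]
    field_simp
    ring
  · exact fun h => hQS' (hf.polar_symm hD hS' hlPS'.right hl.right h)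

/-- The vertices of a quadrilateral of lines of zeros are linearly independent. -/
theorem quadrilateral_linearIndependent (hf : IsExtremalForm m f) (hD : IsPolar m f D)
    {P Q R S : V} (hPQ : VanishesOnLine f P Q) (hPS : VanishesOnLine f P S)
    (hRQ : VanishesOnLine f R Q) (hRS : VanishesOnLine f R S) (h₁ : D P R ≠ 0) (h₂ : D Q S ≠ 0)
    (h₃ : D R P ≠ 0) (h₄ : D S Q ≠ 0) : LinearIndependent K ![P, R, Q, S] := by
  rw [Fintype.linearIndependent_iff]
  intro g hg
  simp only [Fin.sum_univ_four, Matrix.cons_val] at hg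
  have key : ∀ x, g 0 * D x P + g 1 * D x R + g 2 * D x Q + g 3 * D x S = 0 := fun x => by
    have := congrArg (D x) hg
    simpa using this
  have k₀ := key R
  have k₁ := key P
  have k₂ := key S
  have k₃ := key Q
  rw [hf.polar_self hD hRS.left, hf.polar_eq_zero hD hRQ, hf.polar_eq_zero hD hRS] at k₀
  rw [hf.polar_self hD hPQ.left, hf.polar_eq_zero hD hPQ, hf.polar_eq_zero hD hPS] at k₁
  rw [hf.polar_self hD hPS.right, hf.polar_eq_zero hD hPS.symm, hf.polar_eq_zero hD hRS.symm] at k₂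
  rw [hf.polar_self hD hPQ.right, hf.polar_eq_zero hD hPQ.symm, hf.polar_eq_zero hD hRQ.symm] at k₃
  simp [h₁, h₂, h₃, h₄] at k₀ k₁ k₂ k₃
  intro i
  fin_cases i <;> assumption

theorem quadrilateral_span (hf : IsExtremalForm m f) {P Q R S : V}
    (h : LinearIndependent K ![P, R, Q, S]) (x : V) :
    ∃ a b c d : K, x = a • P + b • R + c • Q + d • S := by
  have hs := h.span_eq_top_of_card_eq_finrank' (by simp [hf.finrank_eq])
  have hx : x ∈ Submodule.span K (Set.range ![P, R, Q, S]) := by rw [hs]; trivial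
  obtain ⟨c, hc⟩ := (Submodule.mem_span_range_iff_exists_fun K).1 hx
  refine ⟨c 0, c 1, c 2, c 3, ?_⟩
  rw [← hc]
  simp [Fin.sum_univ_four]

end IsExtremalForm

end Quadrangle

section Semilinear

variable {V : Type} [AddCommGroup V] [Module K V] [Fintype K] [Fintype V] [DecidableEq K]
  {m : ℕ} {f : V → K} {D : V → V →ₗ[K] K}

namespace IsExtremalForm

theorem notMem_span_of_polar_ne_zero (hf : IsExtremalForm m f) (hD : IsPolar m f D) {P Q w : V}
    (hl : VanishesOnLine f P Q) (h : D P w ≠ 0) : w ∉ Submodule.span K {P, Q} := by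
  rintro hw
  obtain ⟨a, b, rfl⟩ := Submodule.mem_span_pair.1 hw
  simp [hf.polar_self hD hl.left, hf.polar_eq_zero hD hl] at h

/-- The tangent planes along a line of zeros depend on the point in a semilinear way. -/
theorem polar_line_aux (hf : IsExtremalForm m f) (hD : IsPolar m f D) {P Q : V}
    (hPQ : LinearIndependent K ![P, Q]) (hl : VanishesOnLine f P Q) :
    (∀ a b : K, D (a • P + b • Q) = a ^ m • D P + b ^ m • D Q) ∧
      ∀ a b : K, (a + b) ^ m = a ^ m + b ^ m := by
  obtain ⟨R, S, hPS, hRQ, hRS, h₁, h₂, h₃, h₄⟩ := hf.exists_quadrilateral hD hPQ hl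
  have hind := hf.quadrilateral_linearIndependent hD hl hPS hRQ hRS h₁ h₂ h₃ h₄
  have hm : m ≠ 0 := by have := hf.one_le; omega
  have kR : ∀ a b : K, D (a • P + b • Q) R = a ^ m * D P R := by
    intro a b
    obtain ⟨k, l, μ, T, hk, hlμ, hT, -, h⟩ := hf.exists_pencil_polar hD hPQ hl
      (hf.notMem_span_of_polar_ne_zero hD hl h₁)
    have e₁ := h 0 1
    have e₂ := h 1 0
    simp [hf.polar_eq_zero hD hRQ.symm, hk, hm] at e₁ e₂
    rw [h, e₁, e₂]
    ring
  have kS : ∀ a b : K, D (a • P + b • Q) S = b ^ m * D Q S := by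
    intro a b
    obtain ⟨k, l, μ, T, hk, hlμ, hT, -, h⟩ := hf.exists_pencil_polar hD
      (linearIndependent_symm hPQ) hl.symm (hf.notMem_span_of_polar_ne_zero hD hl.symm h₂)
    have e₁ := h 0 1
    have e₂ := h 1 0
    simp [hf.polar_eq_zero hD hPS, hk, hm] at e₁ e₂
    rw [add_comm, h, e₁, e₂]
    ring
  have kP : ∀ a b : K, D (a • P + b • Q) P = 0 := fun a b => by
    simpa using hf.polar_eq_zero hD (hl.comb a b 1 0)
  have kQ : ∀ a b : K, D (a • P + b • Q) Q = 0 := fun a b => by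
    simpa using hf.polar_eq_zero hD (hl.comb a b 0 1)
  refine ⟨fun a b => LinearMap.ext fun x => ?_, ?_⟩
  · obtain ⟨x₀, x₁, x₂, x₃, rfl⟩ := hf.quadrilateral_span hind x
    simp only [map_add, map_smul, LinearMap.add_apply, LinearMap.smul_apply, smul_eq_mul, kP, kQ,
      kR, kS, hf.polar_self hD hl.left, hf.polar_self hD hl.right, hf.polar_eq_zero hD hl,
      hf.polar_eq_zero hD hl.symm, hf.polar_eq_zero hD hPS, hf.polar_eq_zero hD hRQ.symm]
    ring
  · have hPRS : D P (R + S) = D P R := by rw [map_add, hf.polar_eq_zero hD hPS, add_zero]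
    obtain ⟨k, l, μ, T, hk, hlμ, hT, -, h⟩ := hf.exists_pencil_polar hD hPQ hl
      (hf.notMem_span_of_polar_ne_zero hD hl (w := R + S) (by rwa [hPRS]))
    have h' : ∀ a b, a ^ m * D P R + b ^ m * D Q S = k * (l * a + μ * b) ^ m := fun a b => by
      rw [← h, map_add, kR, kS]
    have e₁ : D P R = k * l ^ m := by simpa [hm] using h' 1 0
    have e₂ : D Q S = k * μ ^ m := by simpa [hm] using h' 0 1
    have hl0 : l ≠ 0 := by
      rintro rfl
      simp [hm] at e₁
      exact h₁ e₁
    have hμ0 : μ ≠ 0 := by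
      rintro rfl
      simp [hm] at e₂
      exact h₂ e₂
    intro a b
    have := h' (a / l) (b / μ)
    rw [e₁, e₂, mul_div_cancel₀ _ hl0, mul_div_cancel₀ _ hμ0] at this
    apply mul_left_cancel₀ hk
    rw [← this, div_pow, div_pow]
    field_simp

theorem exists_zero (hf : IsExtremalForm m f) : ∃ P, P ≠ 0 ∧ f P = 0 := by
  by_contra! hc
  have : (Finset.univ.filter fun x => f x = 0).card ≤ 1 := by
    refine Finset.card_le_one.2 fun x hx y hy => ?_
    rw [not_ne_iff.1 fun h => hc x h (Finset.mem_filter.1 hx).2,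
      not_ne_iff.1 fun h => hc y h (Finset.mem_filter.1 hy).2]
  have h1 := hf.card_zeros
  have h2 := hf.one_le
  have h3 := hf.lt
  have h4 : m * Fintype.card K ≤ m * Fintype.card K ^ 3 :=
    Nat.mul_le_mul_left _ (Nat.le_self_pow (by norm_num) _)
  nlinarith

theorem add_pow_eq (hf : IsExtremalForm m f) (a b : K) : (a + b) ^ m = a ^ m + b ^ m := by
  obtain ⟨D, hD⟩ := hf.isForm.exists_isPolar
  obtain ⟨P, hP, hfP⟩ := hf.exists_zero
  obtain ⟨Q, hPQ, hl⟩ := hf.exists_vanishesOnLine hP hfP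
  exact (hf.polar_line_aux hD hPQ hl).2 a b

theorem neg_pow_eq (hf : IsExtremalForm m f) (a : K) : (-a) ^ m = -a ^ m := by
  have hm : m ≠ 0 := by have := hf.one_le; omega
  have := hf.add_pow_eq a (-a)
  rw [add_neg_cancel, zero_pow hm] at this
  linear_combination -this

theorem polar_line (hf : IsExtremalForm m f) (hD : IsPolar m f D) {P Q : V}
    (hl : VanishesOnLine f P Q) (a b : K) : D (a • P + b • Q) = a ^ m • D P + b ^ m • D Q := by
  by_cases hPQ : LinearIndependent K ![P, Q]
  · exact (hf.polar_line_aux hD hPQ hl).1 a b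
  · by_cases hP : P = 0
    · subst hP
      have hm : m ≠ 0 := by have := hf.one_le; omega
      have h0 : D 0 = 0 := by simpa [hm] using hD.map_smul 0 0
      simp [hD.map_smul, h0]
    · rw [LinearIndependent.pair_iff' hP] at hPQ
      push Not at hPQ
      obtain ⟨c, rfl⟩ := hPQ
      rw [smul_smul, ← add_smul, hD.map_smul, hD.map_smul, hf.add_pow_eq, add_smul, smul_smul,
        mul_pow]

theorem pow_injective (hf : IsExtremalForm m f) : Function.Injective fun a : K => a ^ m := by
  intro a b (hab : a ^ m = b ^ m)
  have hm : m ≠ 0 := by have := hf.one_le; omega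
  have h1 := hf.add_pow_eq (a - b) b
  rw [sub_add_cancel, hab] at h1
  exact sub_eq_zero.1 (pow_eq_zero_iff hm |>.1 (by linear_combination -h1))

theorem exists_polar_line_eq_zero (hf : IsExtremalForm m f) (hD : IsPolar m f D) {P Q : V}
    (hPQ : LinearIndependent K ![P, Q]) (hl : VanishesOnLine f P Q) (x : V) :
    ∃ a b : K, a • P + b • Q ≠ 0 ∧ D (a • P + b • Q) x = 0 := by
  have hsurj := Finite.surjective_of_injective hf.pow_injective
  by_cases h0 : D P x = 0
  · exact ⟨1, 0, by simpa using hPQ.ne_zero 0, by simpa using h0⟩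
  · obtain ⟨a, ha⟩ := hsurj (-D Q x / D P x)
    refine ⟨a, 1, fun h => ?_, ?_⟩
    · exact one_ne_zero (LinearIndependent.pair_iff.1 hPQ a 1 h).2
    · rw [hf.polar_line hD hl]
      simp only at ha
      simp only [one_pow, one_smul, LinearMap.add_apply, LinearMap.smul_apply, smul_eq_mul, ha]
      field_simp
      ring

end IsExtremalForm

end Semilinear

section Global

variable {V : Type} [AddCommGroup V] [Module K V] [Fintype K] [Fintype V] [DecidableEq K]
  {m : ℕ} {f : V → K} {D : V → V →ₗ[K] K}

namespace IsExtremalForm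

/-- The tangent plane section at a zero `P` consists of `m + 1` lines through `P`. -/
theorem exists_tangent_pencil (hf : IsExtremalForm m f) (hD : IsPolar m f D) {P : V}
    (hP : P ≠ 0) (hfP : f P = 0) :
    ∃ (Q w : V) (k μ : K) (T : Finset K), VanishesOnLine f P Q ∧ μ ≠ 0 ∧ T.card = m ∧
      (∀ x, D P x = 0 → ∃ a b c : K, x = a • P + b • Q + c • w) ∧
      k ≠ 0 ∧ ∀ a b c : K, f (a • P + b • Q + c • w) = c * (k * ∏ τ ∈ T, (μ * b + τ * c)) := by
  obtain ⟨Q, hPQ, hl⟩ := hf.exists_vanishesOnLine hP hfP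
  obtain ⟨R, S, hPS, hRQ, hRS, h₁, h₂, h₃, h₄⟩ := hf.exists_quadrilateral hD hPQ hl
  have hind := hf.quadrilateral_linearIndependent hD hl hPS hRQ hRS h₁ h₂ h₃ h₄
  have hS : S ∉ Submodule.span K {P, Q} := by
    rw [Set.pair_comm]
    exact hf.notMem_span_of_polar_ne_zero hD hl.symm h₂
  obtain ⟨k, l, μ, T, hk, hlμ, hT, h, hp⟩ := hf.exists_pencil_polar hD hPQ hl hS
  have hm : m ≠ 0 := by have := hf.one_le; omega
  obtain rfl : l = 0 := by
    have := hp 1 0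
    simpa [hf.polar_eq_zero hD hPS, hk, hm] using this
  refine ⟨Q, S, k, μ, T, hl, by simpa using hlμ, hT, fun x hx => ?_, hk, fun a b c => ?_⟩
  · obtain ⟨a, b, c, d, rfl⟩ := hf.quadrilateral_span hind x
    refine ⟨a, c, d, ?_⟩
    simp [hf.polar_eq_zero hD hPS, hf.polar_eq_zero hD hl, hf.polar_self hD hfP, h₁] at hx
    simp [hx]
  · simpa using h a b c

/-- A property of zeros that propagates along lines of zeros and holds on enough pairwise skew
lines holds at all zeros. -/
theorem forall_zero_of_skew_lines (hf : IsExtremalForm m f) (hD : IsPolar m f D) {p : V → Prop}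
    (hp : ∀ x y, VanishesOnLine f x y → p x → p y → ∀ a b : K, p (a • x + b • y))
    (X Y : Option K → V) (hl : ∀ i, VanishesOnLine f (X i) (Y i))
    (hX : ∀ i, p (X i)) (hY : ∀ i, p (Y i)) (hXY : ∀ i, LinearIndependent K ![X i, Y i])
    (hskew : ∀ i j, i ≠ j → ∀ s t s' t' c : K, s • X i + t • Y i = c • (s' • X j + t' • Y j) →
      s • X i + t • Y i = 0) {P : V} (hP : P ≠ 0) (hfP : f P = 0) : p P := by
  classical
  have hz : ∀ i, ∃ s t : K, s • X i + t • Y i ≠ 0 ∧ D P (s • X i + t • Y i) = 0 := by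
    intro i
    by_cases h : D P (X i) = 0
    · exact ⟨1, 0, by simpa using (hXY i).ne_zero 0, by simpa using h⟩
    · refine ⟨-D P (Y i) / D P (X i), 1, fun h0 => ?_, ?_⟩
      · exact one_ne_zero (LinearIndependent.pair_iff.1 (hXY i) _ _ h0).2
      · rw [map_add, map_smul, map_smul, smul_eq_mul, smul_eq_mul]
        field_simp
        ring
  choose s t hz₁ hz₂ using hz
  obtain ⟨Q, w, k, μ, T, hPQ, hμ, hT, hspan, hk, h⟩ := hf.exists_tangent_pencil hD hP hfP
  let u : Option K → V := fun i => i.elim Q fun τ => (-τ / μ) • Q + w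
  have hu : ∀ i ∈ Finset.insertNone T, VanishesOnLine f P (u i) := by
    rintro (_ | τ) hi a b
    · exact hPQ a b
    · have hτ : τ ∈ T := by simpa using hi
      have := h a (b * (-τ / μ)) b
      rw [Finset.prod_eq_zero hτ (by field_simp; ring), mul_zero, mul_zero] at this
      rw [← this]
      congr 1
      simp only [u, Option.elim_some]
      module
  have hcl : ∀ i, ∃ j ∈ Finset.insertNone T, ∃ a b : K,
      s i • X i + t i • Y i = a • P + b • u j := by
    intro i
    obtain ⟨a, b, c, habc⟩ := hspan _ (hz₂ i)
    have h0 := hl i (s i) (t i)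
    rw [habc, h] at h0
    rcases mul_eq_zero.1 h0 with rfl | h0
    · exact ⟨none, by simp, a, b, by simpa [u] using habc⟩
    · obtain ⟨τ, hτ, h0⟩ := Finset.prod_eq_zero_iff.1 ((mul_eq_zero.1 h0).resolve_left hk)
      refine ⟨some τ, by simpa using hτ, a, c, ?_⟩
      have hb : b = c * (-τ / μ) := by field_simp; linear_combination h0
      rw [habc, hb]
      simp only [u, Option.elim_some]
      module
  choose j hj₁ a b hab using hcl
  obtain ⟨i, -, i', -, hne, heq⟩ := Finset.exists_ne_map_eq_of_card_lt_of_maps_to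
    (s := Finset.univ) (t := Finset.insertNone T) (f := j)
    (by have := hf.lt; simp [Fintype.card_option, hT]; omega) (fun i _ => hj₁ i)
  have hdet : a i * b i' - a i' * b i ≠ 0 := by
    intro h0
    have h1 : s i • X i + t i • Y i ≠ 0 := hz₁ i
    have h2 : s i' • X i' + t i' • Y i' ≠ 0 := hz₁ i'
    by_cases ha : a i' = 0
    · by_cases hb : b i' = 0
      · exact h2 (by rw [hab, ha, hb]; simp)
      · refine h1 (hskew i i' hne _ _ (s i') (t i') (b i / b i') ?_)
        have : a i = 0 := by simpa [ha, hb] using h0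
        rw [hab, hab, ha, this, heq, zero_smul, zero_add, zero_add, smul_smul,
          div_mul_cancel₀ _ hb]
    · refine h1 (hskew i i' hne _ _ (s i') (t i') (a i / a i') ?_)
      have : b i = a i / a i' * b i' := by field_simp; linear_combination -h0
      rw [hab, hab, heq, smul_add, smul_smul, smul_smul, div_mul_cancel₀ _ ha, ← this]
  have hl' : VanishesOnLine f (s i • X i + t i • Y i) (s i' • X i' + t i' • Y i') := by
    rw [hab, hab, ← heq]
    exact (hu _ (hj₁ i)).comb _ _ _ _
  obtain ⟨δ, hδ⟩ : ∃ δ, δ = a i * b i' - a i' * b i := ⟨_, rfl⟩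
  rw [← hδ] at hdet
  have := hp _ _ hl' (hp _ _ (hl i) (hX i) (hY i) _ _) (hp _ _ (hl i') (hX i') (hY i') _ _)
    (b i' / δ) (-b i / δ)
  convert this using 1
  rw [hab, hab, ← heq]
  match_scalars
  · field_simp
    linear_combination hδ
  · field_simp
    ring

omit [Fintype K] [Fintype V] [DecidableEq K] in
theorem quadrilateral_eq_zero {P Q R S : V} (h : LinearIndependent K ![P, R, Q, S]) {a b c d : K}
    (h0 : a • P + b • R + c • Q + d • S = 0) : a = 0 ∧ b = 0 ∧ c = 0 ∧ d = 0 := by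
  have := Fintype.linearIndependent_iff.1 h ![a, b, c, d]
    (by simpa [Fin.sum_univ_succ, ← add_assoc] using h0)
  exact ⟨this 0, this 1, this 2, this 3⟩

/-- The tangent planes depend on the point in a semilinear way. -/
theorem polar_add_of_zeros (hf : IsExtremalForm m f) (hD : IsPolar m f D) :
    ∃ E : V → V →ₗ[K] K, (∀ y, IsForm m fun x => E x y) ∧
      (∀ x y, E (x + y) = E x + E y) ∧ ∀ x, f x = 0 → D x = E x := by
  obtain ⟨P, hP, hfP⟩ := hf.exists_zero
  obtain ⟨Q, hPQ, hl⟩ := hf.exists_vanishesOnLine hP hfP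
  obtain ⟨R, S, hPS, hRQ, hRS, h₁, h₂, h₃, h₄⟩ := hf.exists_quadrilateral hD hPQ hl
  have hind := hf.quadrilateral_linearIndependent hD hl hPS hRQ hRS h₁ h₂ h₃ h₄
  have hm : m ≠ 0 := by have := hf.one_le; omega
  let B := basisOfLinearIndependentOfCardEqFinrank hind (by simp [hf.finrank_eq])
  have hB : ∀ i, B i = ![P, R, Q, S] i := fun i => by simp [B]
  let E : V → V →ₗ[K] K := fun x => ∑ i, (B.coord i x) ^ m • D (B i)
  have hE : ∀ (a b : K) (x y : V), E (a • x + b • y) = a ^ m • E x + b ^ m • E y := by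
    intro a b x y
    simp only [E, map_add, map_smul, hf.add_pow_eq, smul_eq_mul, mul_pow, add_smul,
      Finset.sum_add_distrib, Finset.smul_sum, smul_smul]
  have hEB : ∀ i, D (B i) = E (B i) := by
    intro i
    simp only [E, Module.Basis.coord_apply, Module.Basis.repr_self]
    rw [Finset.sum_eq_single i (by intro j _ hj; simp [hj.symm, hm])
      (by simp)]
    simp
  have hEP : D P = E P := by simpa [hB] using hEB 0
  have hER : D R = E R := by simpa [hB] using hEB 1
  have hEQ : D Q = E Q := by simpa [hB] using hEB 2
  have hES : D S = E S := by simpa [hB] using hEB 3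
  have hcl : ∀ x y, VanishesOnLine f x y → D x = E x → D y = E y →
      ∀ a b : K, D (a • x + b • y) = E (a • x + b • y) := by
    intro x y hxy hx hy a b
    rw [hf.polar_line hD hxy, hE, hx, hy]
  refine ⟨E, fun y => ?_, fun x y => by simpa using hE 1 1 x y, fun x hx => ?_⟩
  · simp only [E, LinearMap.sum_apply, LinearMap.smul_apply, smul_eq_mul]
    refine IsForm.sum _ fun i _ => ?_
    simpa [mul_comm] using (IsForm.linear_pow (B.coord i) m).const_mul (D (B i) y)
  by_cases hx0 : x = 0
  · have h0 : E 0 = 0 := by simpa [hm] using hE 0 0 0 0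
    subst hx0
    rw [h0]
    ext y
    simpa [hm] using congrArg (· y) (hD.map_smul 0 0)
  let α : Option K → K := fun i => i.elim 0 fun _ => 1
  let β : Option K → K := fun i => i.elim 1 id
  have hαβ : ∀ i j, α i * β j = α j * β i → i = j := by
    rintro (_ | i) (_ | j) <;> simp [α, β]
    exact fun h => h.symm
  have hαβ0 : ∀ i, α i ≠ 0 ∨ β i ≠ 0 := by
    rintro (_ | i) <;> simp [α, β]
  let X : Option K → V := fun i => α i • P + β i • Q
  let Y : Option K → V := fun i => (β i ^ m * D Q S) • R + (-(α i ^ m * D P R)) • S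
  have hXz : ∀ i, f (X i) = 0 := fun i => hl _ _
  have hX : ∀ i, D (X i) = E (X i) := fun i => hcl _ _ hl hEP hEQ _ _
  have hY : ∀ i, D (Y i) = E (Y i) := fun i => hcl _ _ hRS hER hES _ _
  have hform : ∀ i (s t : K), s • X i + t • Y i = (s * α i) • P + (t * (β i ^ m * D Q S)) • R +
      (s * β i) • Q + (-(t * (α i ^ m * D P R))) • S := fun i s t => by
    simp only [X, Y]
    module
  have hzero : ∀ i (s t : K), s * α i = 0 → t * (β i ^ m * D Q S) = 0 → s * β i = 0 →
      t * (α i ^ m * D P R) = 0 → s = 0 ∧ t = 0 := by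
    intro i s t e₁ e₂ e₃ e₄
    have := hαβ0 i
    simp [h₁, h₂, hm] at e₁ e₂ e₃ e₄
    tauto
  have hXY : ∀ i, LinearIndependent K ![X i, Y i] := by
    intro i
    rw [LinearIndependent.pair_iff]
    intro s t hst
    rw [hform] at hst
    obtain ⟨e₁, e₂, e₃, e₄⟩ := quadrilateral_eq_zero hind hst
    exact hzero i s t e₁ e₂ e₃ (neg_eq_zero.1 e₄)
  refine hf.forall_zero_of_skew_lines hD (p := fun x => D x = E x) hcl X Y (fun i => ?_) hX hY
    hXY ?_ hx0 hx
  · by_cases h0 : X i = 0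
    · exact absurd h0 (by simpa using (hXY i).ne_zero 0)
    refine hf.vanishesOnLine_of_polar_eq_zero hD h0 (hXz i) (hRS _ _) ?_
    simp only [X, Y]
    rw [hf.polar_line hD hl]
    simp [hf.polar_eq_zero hD hPS, hf.polar_eq_zero hD hRQ.symm]
    ring
  · intro i j hij s t s' t' c h
    rw [hform, hform] at h
    obtain ⟨e₁, e₂, e₃, e₄⟩ := quadrilateral_eq_zero hind
      (a := s * α i - c * (s' * α j)) (b := t * (β i ^ m * D Q S) - c * (t' * (β j ^ m * D Q S)))
      (c := s * β i - c * (s' * β j))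
      (d := c * (t' * (α j ^ m * D P R)) - t * (α i ^ m * D P R)) (by
        rw [← sub_eq_zero] at h
        rw [← h]
        module)
    have d₁ : α i * β j - α j * β i ≠ 0 := fun h => hij (hαβ i j (sub_eq_zero.1 h))
    have d₂ : (α i * β j) ^ m - (α j * β i) ^ m ≠ 0 := fun h =>
      hij (hαβ i j (hf.pow_injective (sub_eq_zero.1 h)))
    have hs : s = 0 := by
      refine (mul_eq_zero.1 ?_).resolve_right d₁
      linear_combination β j * e₁ - α j * e₃
    have ht : t = 0 := by
      refine (mul_eq_zero.1 ?_).resolve_right (mul_ne_zero d₂ (mul_ne_zero h₁ h₂))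
      rw [mul_pow, mul_pow]
      linear_combination -(β j ^ m * D Q S) * e₄ - α j ^ m * D P R * e₂
    rw [hs, ht, zero_smul, zero_smul, add_zero]

end IsExtremalForm

end Global

section Additive

variable {V : Type} [AddCommGroup V] [Module K V] [Fintype K] [Fintype V] [DecidableEq K]
  {m : ℕ} {f : V → K} {D : V → V →ₗ[K] K}

namespace IsExtremalForm

theorem form_eq_zero_of_zeros (hf : IsExtremalForm m f) (hD : IsPolar m f D) {h : V → K}
    (hh : IsForm m h) (h0 : ∀ x, f x = 0 → h x = 0) (x : V) : h x = 0 := by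
  by_cases hx : f x = 0
  · exact h0 x hx
  obtain ⟨R, hR, hfR⟩ := hf.exists_zero
  obtain ⟨S, hRS, hl⟩ := hf.exists_vanishesOnLine hR hfR
  obtain ⟨r, s, hP, hPx⟩ := hf.exists_polar_line_eq_zero hD hRS hl x
  obtain ⟨Q, w, k, μ, T, hPQ, hμ, hT, hspan, hk, hfe⟩ := hf.exists_tangent_pencil hD hP (hl r s)
  generalize r • R + s • S = P at *
  obtain ⟨a, b, c, rfl⟩ := hspan x hPx
  have hc : c ≠ 0 := by
    rintro rfl
    exact hx (by rw [hfe, zero_mul])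
  obtain ⟨p, hp₁, hp₂, hp₃⟩ := hh.exists_line (a • P + b • Q + c • w) Q
  have hp : p = 0 := by
    by_contra hp
    have hroots := Polynomial.card_filter_eval_le hp
    have hlt : p.natDegree < m := by
      refine lt_of_le_of_ne hp₁ fun he => hp ?_
      rw [← Polynomial.leadingCoeff_eq_zero, Polynomial.leadingCoeff, he, hp₂, h0 Q hPQ.right]
    have hle : T.card ≤ (Finset.univ.filter fun t => p.eval t = 0).card := by
      refine Finset.card_le_card_of_injOn (fun τ => -(τ * c) / μ - b) (fun τ hτ => ?_) ?_
      · simp only [Finset.coe_filter, Finset.mem_univ, true_and, Set.mem_ofPred_eq, hp₃]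
        apply h0
        rw [show a • P + b • Q + c • w + (-(τ * c) / μ - b) • Q =
          a • P + (-(τ * c) / μ) • Q + c • w by module, hfe, Finset.prod_eq_zero hτ, mul_zero,
          mul_zero]
        field_simp
        ring
      · intro τ _ τ' _ h
        field_simp at h
        have : (τ - τ') * c = 0 := by linear_combination -h
        exact sub_eq_zero.1 ((mul_eq_zero.1 this).resolve_right hc)
    omega
  simpa [hp] using (hp₃ 0).symm

theorem polar_add (hf : IsExtremalForm m f) (hD : IsPolar m f D) (x y : V) :
    D (x + y) = D x + D y := by
  obtain ⟨E, hE₁, hE₂, hE₃⟩ := hf.polar_add_of_zeros hD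
  have : ∀ x, D x = E x := by
    intro x
    ext y
    have := hf.form_eq_zero_of_zeros hD ((hD.isForm y).add ((hE₁ y).const_mul (-1)))
      (fun x hx => by rw [hE₃ x hx]; ring) x
    linear_combination this
  rw [this, this, this, hE₂]

end IsExtremalForm

end Additive

section FieldPowers

variable [Fintype K] {m : ℕ}

theorem natCast_eq_zero_of_add_pow (hm : 2 ≤ m) (hlt : m < Fintype.card K)
    (hadd : ∀ a b : K, (a + b) ^ m = a ^ m + b ^ m) : (m : K) = 0 := by
  have hp : (Polynomial.X + 1 : Polynomial K) ^ m - Polynomial.X ^ m - 1 = 0 := by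
    refine Polynomial.eq_zero_of_forall_eval (lt_of_le_of_lt ?_ hlt) fun t => ?_
    · compute_degree
    · simp [hadd]
  have := congrArg (fun p => Polynomial.coeff p 1) hp
  simpa [Polynomial.coeff_X_add_one_pow, Polynomial.coeff_X_pow, Polynomial.coeff_one,
    show 1 ≠ m by omega] using this

theorem exists_pow_eq_of_pow_eq_one {a b : ℕ} (hab : Fintype.card K - 1 = a * b) (θ : K)
    (h0 : θ ≠ 0) (hθ : θ ^ a = 1) : ∃ ρ : K, ρ ≠ 0 ∧ ρ ^ b = θ := by
  classical
  obtain ⟨g, hg⟩ := IsCyclic.exists_generator (α := Kˣ)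
  obtain ⟨j, hj⟩ := (Submonoid.mem_powers_iff _ _).1
    (mem_powers_iff_mem_zpowers.2 (hg (Units.mk0 θ h0)))
  have hord : orderOf g = a * b := by
    rw [orderOf_eq_card_of_forall_mem_zpowers hg, Nat.card_eq_fintype_card, Fintype.card_units, hab]
  have h1 : g ^ (j * a) = 1 := by
    rw [pow_mul, hj]
    ext
    simpa using hθ
  have ha : 0 < a := by
    have := orderOf_pos g
    rw [hord] at this
    exact Nat.pos_of_mul_pos_right this
  have h2 : b ∣ j := by
    have := orderOf_dvd_of_pow_eq_one h1
    rw [hord, mul_comm j] at this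
    exact Nat.dvd_of_mul_dvd_mul_left ha this
  obtain ⟨i, rfl⟩ := h2
  refine ⟨((g ^ i : Kˣ) : K), Units.ne_zero _, ?_⟩
  rw [← Units.val_pow_eq_pow_val, ← pow_mul, mul_comm, hj, Units.val_mk0]

theorem card_eq_sq (hm : 2 ≤ m) (hlt : m < Fintype.card K)
    (hadd : ∀ a b : K, (a + b) ^ m = a ^ m + b ^ m) (hsq : ∀ a : K, a ^ (m * m) = a) :
    Fintype.card K = m ^ 2 := by
  classical
  obtain ⟨p, hp⟩ := CharP.exists K
  obtain ⟨n, hprime, hcard⟩ := FiniteField.card K p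
  have := Fact.mk hprime
  let _ := ZMod.algebra K p
  have hpw : ∃ k, k < (n : ℕ) ∧ m = p ^ k := by
    let φ₀ : K →+* K :=
      { toFun := fun x => x ^ m
        map_one' := one_pow m
        map_mul' := fun a b => mul_pow a b m
        map_zero' := zero_pow (by omega)
        map_add' := hadd }
    let φ : K →ₐ[ZMod p] K :=
      { φ₀ with
        commutes' := fun r => RingHom.congr_fun (f := φ₀.comp (algebraMap (ZMod p) K))
          (Subsingleton.elim _ (algebraMap (ZMod p) K)) r }
    obtain ⟨⟨k, hk⟩, h⟩ := (FiniteField.bijective_frobeniusAlgHom_pow (ZMod p) K).2 φ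
    have hn : Module.finrank (ZMod p) K = n := by
      have := Module.card_eq_pow_finrank (K := ZMod p) (V := K)
      rw [hcard, ZMod.card] at this
      exact (Nat.pow_right_injective hprime.two_le this).symm
    rw [hn] at hk
    have hev : ∀ x : K, x ^ m = x ^ p ^ k := fun x => by
      have := DFunLike.congr_fun h x
      simp only [AlgHom.coe_pow, FiniteField.coe_frobeniusAlgHom, pow_iterate, ZMod.card] at this
      exact this.symm
    have hlt' : p ^ k < Fintype.card K := hcard ▸ Nat.pow_lt_pow_right hprime.one_lt hk
    refine ⟨k, hk, ?_⟩
    have hpoly : (Polynomial.X ^ m - Polynomial.X ^ p ^ k : Polynomial K) = 0 := by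
      refine Polynomial.eq_zero_of_forall_eval ?_ fun t => by simp [hev]
      refine (Polynomial.natDegree_sub_le _ _).trans_lt ?_
      simp [hlt, hlt']
    by_contra hne
    simpa [Polynomial.coeff_X_pow, hne] using congrArg (fun p => Polynomial.coeff p m) hpoly
  obtain ⟨k, hkn, rfl⟩ := hpw
  have hdvd : Fintype.card K - 1 ∣ p ^ (2 * k) - 1 := by
    obtain ⟨g, hg⟩ := IsCyclic.exists_generator (α := Kˣ)
    rw [← Fintype.card_units, ← Nat.card_eq_fintype_card,
      ← orderOf_eq_card_of_forall_mem_zpowers hg]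
    apply orderOf_dvd_of_pow_eq_one
    have h1 : g ^ (p ^ (2 * k)) = g := by
      ext
      have := hsq (g : K)
      rwa [← pow_add, ← two_mul] at this
    have h2 : g ^ (p ^ (2 * k) - 1) * g = 1 * g := by
      rw [← pow_succ, Nat.sub_add_cancel (Nat.pos_of_ne_zero (by simp [hprime.ne_zero])), h1,
        one_mul]
    exact mul_right_cancel h2
  rw [hcard] at hdvd ⊢
  have hgcd := Nat.pow_sub_one_gcd_pow_sub_one p n (2 * k)
  rw [Nat.gcd_eq_left hdvd] at hgcd
  have hnk : (n : ℕ) ∣ 2 * k := by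
    have : p ^ (n : ℕ) = p ^ Nat.gcd n (2 * k) := by
      have h1 : 0 < p ^ (n : ℕ) := pow_pos hprime.pos _
      have h2 : 0 < p ^ Nat.gcd n (2 * k) := pow_pos hprime.pos _
      omega
    rw [Nat.pow_right_injective hprime.two_le this]
    exact Nat.gcd_dvd_right _ _
  have hk0 : k ≠ 0 := by
    rintro rfl
    simp at hm
  obtain ⟨c, hc⟩ := hnk
  have : c = 1 := by
    have : c < 2 := by
      by_contra! h
      have := Nat.mul_le_mul_left (n : ℕ) h
      omega
    interval_cases c
    · omega
    · rfl
  rw [← pow_mul, mul_comm k, hc, this, mul_one]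

end FieldPowers

section NormalForm

variable {V : Type} [AddCommGroup V] [Module K V] [Fintype K] [Fintype V] [DecidableEq K]
  {m : ℕ} {f : V → K} {D : V → V →ₗ[K] K}

omit [Fintype K] [Fintype V] [DecidableEq K] in
theorem linearIndependent_vec4 {e₀ e₁ e₂ e₃ : V}
    (h : ∀ a b c d : K, a • e₀ + b • e₁ + c • e₂ + d • e₃ = 0 → a = 0 ∧ b = 0 ∧ c = 0 ∧ d = 0) :
    LinearIndependent K ![e₀, e₁, e₂, e₃] := by
  rw [Fintype.linearIndependent_iff]
  intro g hg
  obtain ⟨h₀, h₁, h₂, h₃⟩ := h (g 0) (g 1) (g 2) (g 3)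
    (by rw [← hg]; simp [Fin.sum_univ_succ, add_assoc])
  intro i
  fin_cases i <;> assumption

namespace IsExtremalForm

/-- An extremal quadratic form is hyperbolic. -/
theorem exists_quadric_basis (hf : IsExtremalForm 1 f) :
    ∃ e : Fin 4 → V, LinearIndependent K e ∧
      ∀ x : Fin 4 → K, f (∑ i, x i • e i) = x 0 * x 1 - x 2 * x 3 := by
  obtain ⟨D, hD⟩ := hf.isForm.exists_isPolar
  obtain ⟨P, hP, hfP⟩ := hf.exists_zero
  obtain ⟨Q, hPQ, hl⟩ := hf.exists_vanishesOnLine hP hfP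
  obtain ⟨R, S, hPS, hRQ, hRS, h₁, h₂, h₃, h₄⟩ := hf.exists_quadrilateral hD hPQ hl
  have hind := hf.quadrilateral_linearIndependent hD hl hPS hRQ hRS h₁ h₂ h₃ h₄
  refine ⟨![P, (D P R)⁻¹ • R, Q, (-(D Q S)⁻¹) • S], linearIndependent_vec4 ?_, fun x => ?_⟩
  · intro a b c d h
    obtain ⟨e₁, e₂, e₃, e₄⟩ := quadrilateral_eq_zero hind (a := a) (b := b * (D P R)⁻¹) (c := c)
      (d := d * (-(D Q S)⁻¹)) (by rw [← h]; module)
    simp [h₁, h₂] at e₂ e₄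
    exact ⟨e₁, e₂, e₃, e₄⟩
  · set u := x 0 • P + x 2 • Q with hu
    set v := (x 1 * (D P R)⁻¹) • R + (x 3 * -(D Q S)⁻¹) • S with hv
    obtain ⟨p, hp₁, hp₂, hp₃, hp₄⟩ := hD.line u v
    have hp₀ : p.coeff 0 = 0 := by
      rw [Polynomial.coeff_zero_eq_eval_zero, hp₄, zero_smul, add_zero]
      exact hl _ _
    have hDuv : D u v = x 0 * x 1 - x 2 * x 3 := by
      rw [hu, hf.polar_line hD hl, hv]
      simp [hf.polar_eq_zero hD hPS, hf.polar_eq_zero hD hRQ.symm]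
      field_simp
      ring
    have h1 := hp₄ 1
    rw [Polynomial.eval_eq_sum_range' (n := 3) (by omega), Finset.sum_range_succ,
      Finset.sum_range_succ, Finset.sum_range_one, hp₀, hp₃, hDuv, hp₂, hRS] at h1
    rw [show ∑ i, x i • ![P, (D P R)⁻¹ • R, Q, (-(D Q S)⁻¹) • S] i = u + (1 : K) • v by
      simp only [Fin.sum_univ_succ, Finset.univ_unique, Finset.sum_singleton]
      simp [hu, hv]
      module]
    simpa using h1.symm

/-- An extremal form of degree at least three is a sum of two binary Hermitian forms. -/
theorem exists_hermitian_pair (hf : IsExtremalForm m f) (hm : 2 ≤ m) :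
    ∃ (P R Q S : V) (A B θ : K), LinearIndependent K ![P, R, Q, S] ∧ A ≠ 0 ∧ B ≠ 0 ∧ θ ≠ 0 ∧
      θ ^ (m + 1) = 1 ∧ (∀ a : K, a ^ (m * m) = a) ∧
      ∀ a b c d : K, f (a • P + b • R + c • Q + d • S) =
        A * (a ^ m * b) + θ * A ^ m * (b ^ m * a) + B * (c ^ m * d) +
          θ * B ^ m * (d ^ m * c) := by
  obtain ⟨D, hD⟩ := hf.isForm.exists_isPolar
  obtain ⟨P, hP, hfP⟩ := hf.exists_zero
  obtain ⟨Q, hPQ, hl⟩ := hf.exists_vanishesOnLine hP hfP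
  obtain ⟨R, S, hPS, hRQ, hRS, h₁, h₂, h₃, h₄⟩ := hf.exists_quadrilateral hD hPQ hl
  have hind := hf.quadrilateral_linearIndependent hD hl hPS hRQ hRS h₁ h₂ h₃ h₄
  have hm0 : (m : K) = 0 := natCast_eq_zero_of_add_pow hm hf.lt hf.add_pow_eq
  have hneg := hf.neg_pow_eq
  have hDf : ∀ a b c d : K, D (a • P + b • R + c • Q + d • S) =
      a ^ m • D P + b ^ m • D R + c ^ m • D Q + d ^ m • D S := fun a b c d => by
    simp only [hf.polar_add hD, hD.map_smul]
  have hfD : ∀ x, f x = D x x := fun x => by simp [hD.self, hm0]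
  have z : ∀ {x y : V}, VanishesOnLine f x y → D x y = 0 := hf.polar_eq_zero hD
  have key : ∀ b : K, D R P * D Q S ^ m * b ^ (m * m) = D S Q * D P R ^ m * b := by
    intro b
    have := hf.polar_symm hD (P := P + b • Q) (R := (D Q S * b ^ m) • R + (-D P R) • S) ?_
      (by simpa using hl 1 b) (hRS _ _) ?_
    · rw [hf.polar_line hD hRS] at this
      simp [z hRQ, z hPS.symm, hneg, mul_pow] at this
      rw [pow_mul]
      linear_combination this
    · intro h
      exact one_ne_zero (LinearIndependent.pair_iff.1 hPQ 1 b (by simpa using h)).1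
    · have := hf.polar_line hD hl 1 b
      rw [one_smul] at this
      rw [this]
      simp [z hRQ.symm, z hPS]
      ring
  have key' : D R P * D S Q ^ m = D Q S * D P R ^ m := by
    have := hf.polar_symm hD (P := P + S) (R := D S Q • R + (-D P R) • Q) ?_
      (by simpa using hPS 1 1) (hRQ _ _) ?_
    · rw [hf.polar_line hD hRQ] at this
      simp [z hRS, z hl.symm, hneg] at this
      linear_combination this
    · intro h
      exact one_ne_zero (quadrilateral_eq_zero hind (a := 1) (b := 0) (c := 0) (d := 1)
        (by simpa using h)).1
    · rw [hf.polar_add hD]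
      simp [z hRS.symm, z hl]
      ring
  have key₁ : D R P * D Q S ^ m = D S Q * D P R ^ m := by simpa using key 1
  have hsq : ∀ a : K, a ^ (m * m) = a := fun a => by
    have := key a
    rw [key₁] at this
    exact mul_left_cancel₀ (mul_ne_zero h₄ (pow_ne_zero _ h₁)) this
  refine ⟨P, R, Q, S, D P R, D Q S, D R P / D P R ^ m, hind, h₁, h₂,
    div_ne_zero h₃ (pow_ne_zero _ h₁), ?_, hsq, fun a b c d => ?_⟩
  · have e : D R P / D P R ^ m = D S Q / D Q S ^ m := by
      field_simp
      linear_combination key₁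
    rw [pow_succ]
    nth_rw 1 [e]
    rw [div_pow, ← pow_mul, hsq]
    field_simp
    linear_combination key'
  · rw [hfD, hDf]
    simp [hf.polar_self hD hl.left, hf.polar_self hD hl.right, hf.polar_self hD hRS.left,
      hf.polar_self hD hRS.right, z hl, z hl.symm, z hPS, z hPS.symm, z hRQ,
      z hRQ.symm, z hRS, z hRS.symm]
    field_simp
    linear_combination -(c * d ^ m) * key₁

/-- An extremal form of degree at least three is Hermitian. -/
theorem exists_hermitian_basis (hf : IsExtremalForm m f) (hm : 2 ≤ m) :
    Fintype.card K = m ^ 2 ∧ ∃ (e : Fin 4 → V) (ρ : K), LinearIndependent K e ∧ ρ ≠ 0 ∧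
      ∀ x : Fin 4 → K, ρ * f (∑ i, x i • e i) =
        x 0 ^ (m + 1) + x 1 ^ (m + 1) + x 2 ^ (m + 1) + x 3 ^ (m + 1) := by
  obtain ⟨P, R, Q, S, A, B, θ, hind, hA, hB, hθ, hθ₁, hsq, h⟩ := hf.exists_hermitian_pair hm
  have hcard := card_eq_sq hm hf.lt hf.add_pow_eq hsq
  refine ⟨hcard, ?_⟩
  have hadd := hf.add_pow_eq
  have hneg := hf.neg_pow_eq
  have hfac : Fintype.card K - 1 = (m + 1) * (m - 1) := by
    rw [hcard, ← Nat.sq_sub_sq, one_pow]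
  obtain ⟨ρ, hρ, hρθ⟩ := exists_pow_eq_of_pow_eq_one hfac θ hθ hθ₁
  obtain ⟨c, hc, hc₁⟩ := exists_pow_eq_of_pow_eq_one (hfac.trans (mul_comm _ _)) (-1 : K)
    (by simp) (by
      have : (-1 : K) ^ (m - 1) * (-1) = -1 := by
        rw [← pow_succ, Nat.sub_add_cancel (by omega), hneg, one_pow]
      linear_combination -this)
  obtain ⟨z, hz⟩ : ∃ z : K, z + z ^ m = 1 := by
    obtain ⟨y, hy⟩ : ∃ y : K, y + y ^ m ≠ 0 := by
      by_contra! hy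
      have := Polynomial.eq_zero_of_forall_eval
        (p := (Polynomial.X + Polynomial.X ^ m : Polynomial K))
        (lt_of_le_of_lt (by compute_degree; omega) hf.lt) (by simpa using hy)
      have := congrArg (fun p => Polynomial.coeff p 1) this
      simp [Polynomial.coeff_X_pow, show 1 ≠ m by omega] at this
    refine ⟨y / (y + y ^ m), ?_⟩
    rw [div_pow, hadd y, ← pow_mul, hsq, add_comm (y ^ m) y, ← add_div, div_self hy]
  have hρ' : ρ ^ m = ρ * θ := by
    rw [← hρθ, ← pow_succ', Nat.sub_add_cancel (by omega)]
  refine ⟨![P + (z * (ρ * A)⁻¹) • R, c • P + (-(c * z ^ m * (ρ * A)⁻¹)) • R,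
    Q + (z * (ρ * B)⁻¹) • S, c • Q + (-(c * z ^ m * (ρ * B)⁻¹)) • S], ρ,
    linearIndependent_vec4 ?_, hρ, fun x => ?_⟩
  · intro s t u v h0
    obtain ⟨e₁, e₂, e₃, e₄⟩ := quadrilateral_eq_zero hind (a := s + c * t)
      (b := (z * s - c * z ^ m * t) * (ρ * A)⁻¹) (c := u + c * v)
      (d := (z * u - c * z ^ m * v) * (ρ * B)⁻¹) (by rw [← h0]; module)
    have e₂' := (mul_eq_zero.1 e₂).resolve_right (inv_ne_zero (mul_ne_zero hρ hA))
    have e₄' := (mul_eq_zero.1 e₄).resolve_right (inv_ne_zero (mul_ne_zero hρ hB))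
    have ht : t = 0 := (mul_eq_zero.1 (show c * t = 0 by
      linear_combination z * e₁ - e₂' - c * t * hz)).resolve_left hc
    have hv : v = 0 := (mul_eq_zero.1 (show c * v = 0 by
      linear_combination z * e₃ - e₄' - c * v * hz)).resolve_left hc
    subst ht hv
    simpa using And.intro e₁ e₃
  · have hblock : ∀ s t : K, (s + c * t) ^ m * (z * s - c * z ^ m * t) +
        (z * s - c * z ^ m * t) ^ m * (s + c * t) = s ^ (m + 1) + t ^ (m + 1) := by
      intro s t
      rw [sub_eq_add_neg, hadd, hadd, hneg]
      simp only [mul_pow]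
      rw [← pow_mul z, hsq, pow_succ, pow_succ]
      rw [pow_succ] at hc₁
      linear_combination (s ^ m * s - c ^ m * c * (t ^ m * t)) * hz - t ^ m * t * hc₁
    have hscale : ∀ C : K, C ≠ 0 → ∀ y x : K, ρ * (C * (y ^ m * (x * (ρ * C)⁻¹)) +
        θ * C ^ m * ((x * (ρ * C)⁻¹) ^ m * y)) = y ^ m * x + x ^ m * y := by
      intro C hC y x
      rw [mul_pow, inv_pow, mul_pow, hρ']
      field_simp
    rw [show ∑ i, x i • (![P + (z * (ρ * A)⁻¹) • R, c • P + (-(c * z ^ m * (ρ * A)⁻¹)) • R,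
      Q + (z * (ρ * B)⁻¹) • S, c • Q + (-(c * z ^ m * (ρ * B)⁻¹)) • S] : Fin 4 → V) i =
      (x 0 + c * x 1) • P + ((z * x 0 - c * z ^ m * x 1) * (ρ * A)⁻¹) • R +
      (x 2 + c * x 3) • Q + ((z * x 2 - c * z ^ m * x 3) * (ρ * B)⁻¹) • S by
        simp only [Fin.sum_univ_succ, Finset.univ_unique, Finset.sum_singleton]
        simp
        module, h]
    linear_combination hscale A hA (x 0 + c * x 1) (z * x 0 - c * z ^ m * x 1) +
      hscale B hB (x 2 + c * x 3) (z * x 2 - c * z ^ m * x 3) + hblock (x 0) (x 1) +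
      hblock (x 2) (x 3)

end IsExtremalForm

end NormalForm

section Polynomials

variable {n d : ℕ}

theorem isHomogeneous_linForm (a : Fin n → K) : (linForm a).IsHomogeneous 1 :=
  IsHomogeneous.sum _ _ _ fun _ _ => isHomogeneous_C_mul_X _ _

theorem eval_linForm (a v : Fin n → K) : eval v (linForm a) = ∑ i, a i * v i := by
  simp [linForm]

theorem eval_linForm_single (l : (Fin n → K) →ₗ[K] K) (v : Fin n → K) :
    eval v (linForm fun i => l (Pi.single i 1)) = l v := by
  rw [eval_linForm, LinearMap.pi_apply_eq_sum_univ l v]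
  refine Finset.sum_congr rfl fun i _ => ?_
  rw [smul_eq_mul, mul_comm]
  congr 2
  ext j
  simp [Pi.single_apply, eq_comm]

theorem IsForm.mul_form {V : Type} [AddCommGroup V] [Module K V] {a b : ℕ} {f g : V → K}
    (hf : IsForm a f) (hg : IsForm b g) : IsForm (a + b) fun x => f x * g x := by
  induction hf with
  | const c => simpa using hg.const_mul c
  | mul l _ ih =>
    rw [Nat.add_right_comm]
    simpa [mul_assoc] using IsForm.mul l ih
  | add _ _ ih₁ ih₂ => simpa [add_mul] using ih₁.add ih₂

theorem isForm_eval {F : MvPolynomial (Fin n) K} (hF : F.IsHomogeneous d) :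
    IsForm d fun v => eval v F := by
  simp only [eval_eq]
  refine IsForm.sum _ fun s hs => IsForm.const_mul ?_ _
  obtain rfl := hF.degree_eq_sum_deg_support hs
  induction s.support using Finset.induction_on with
  | empty => simpa using IsForm.const 1
  | insert i t hi ih =>
    simp only [Finset.prod_insert hi, Finset.sum_insert hi]
    exact (IsForm.linear_pow (LinearMap.proj i) (s i)).mul_form ih

theorem IsForm.exists_polynomial {f : (Fin n → K) → K} (hf : IsForm d f) :
    ∃ F : MvPolynomial (Fin n) K, F.IsHomogeneous d ∧ ∀ v, eval v F = f v := by
  induction hf with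
  | const c => exact ⟨C c, isHomogeneous_C _ _, by simp⟩
  | mul l _ ih =>
    obtain ⟨F, hF, h⟩ := ih
    refine ⟨linForm (fun i => l (Pi.single i 1)) * F, ?_, fun v => ?_⟩
    · rw [add_comm]
      exact (isHomogeneous_linForm _).mul hF
    · rw [map_mul, eval_linForm_single, h]
  | add _ _ ih₁ ih₂ =>
    obtain ⟨F, hF, h⟩ := ih₁
    obtain ⟨G, hG, k⟩ := ih₂
    exact ⟨F + G, hF.add hG, by simp [h, k]⟩

theorem isHomogeneous_substLin {F : MvPolynomial (Fin n) K} (hF : F.IsHomogeneous d)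
    (M : Matrix (Fin n) (Fin n) K) : (substLin M F).IsHomogeneous d := by
  have h := hF.aeval _ fun i => isHomogeneous_linForm (M i)
  rwa [one_mul] at h

theorem eval_substLin (F : MvPolynomial (Fin n) K) (M : Matrix (Fin n) (Fin n) K)
    (v : Fin n → K) : eval v (substLin M F) = eval (M.mulVec v) F := by
  induction F using MvPolynomial.induction_on with
  | C a => simp [substLin]
  | add F G hF hG => simpa [substLin] using congrArg₂ (· + ·) hF hG
  | mul_X F i hF => simpa [substLin, Matrix.mulVec, dotProduct] using .inl hF

variable [Fintype K]

theorem eq_of_forall_eval_eq {F G : MvPolynomial (Fin n) K} (hF : F.IsHomogeneous d)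
    (hG : G.IsHomogeneous d) (hd : d ≤ Fintype.card K) (h : ∀ v, eval v F = eval v G) : F = G :=
  hF.funext_of_le_card hG h (by simpa using hd)

theorem projEquiv_of_eval {F G : MvPolynomial (Fin n) K} (hF : F.IsHomogeneous d)
    (hG : G.IsHomogeneous d) (hd : d ≤ Fintype.card K) {e : Fin n → Fin n → K}
    (he : LinearIndependent K e) {ρ : K} (hρ : ρ ≠ 0)
    (h : ∀ x : Fin n → K, ρ * eval (∑ i, x i • e i) F = eval x G) : ProjEquiv F G := by
  refine ⟨(Matrix.of e).transpose, ?_, ρ⁻¹, inv_ne_zero hρ, ?_⟩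
  · rw [Matrix.det_transpose, ← Matrix.isUnit_iff_isUnit_det,
      ← Matrix.linearIndependent_rows_iff_isUnit]
    exact he
  · refine eq_of_forall_eval_eq (isHomogeneous_substLin hF _) (hG.C_mul _) hd fun v => ?_
    have hv : (Matrix.of e).transpose.mulVec v = ∑ i, v i • e i := by
      ext i
      simp [Matrix.mulVec, dotProduct, mul_comm]
    rw [eval_substLin, map_mul, eval_C, ← h, inv_mul_cancel_left₀ hρ, hv]

/-- The number of affine zeros of a form in terms of the number of projective ones. -/
theorem card_filter_eval [DecidableEq K] {F : MvPolynomial (Fin n) K} (hF : F.IsHomogeneous d)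
    (hd : d ≠ 0) : (Finset.univ.filter fun v => eval v F = 0).card =
      Nat.card {p : Projectivization K (Fin n → K) // eval p.rep F = 0} *
        (Fintype.card K - 1) + 1 := by
  classical
  have hsmul : ∀ (c : K) v, eval (c • v) F = c ^ d * eval v F := (isForm_eval hF).map_smul
  let φ : {p : Projectivization K (Fin n → K) // eval p.rep F = 0} × Kˣ →
      {v : Fin n → K // v ≠ 0 ∧ eval v F = 0} := fun x =>
    ⟨(x.2 : K) • x.1.1.rep, smul_ne_zero x.2.ne_zero x.1.1.rep_nonzero, by
      rw [hsmul, x.1.2, mul_zero]⟩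
  have hφ : Function.Bijective φ := by
    constructor
    · rintro ⟨⟨p, hp⟩, c⟩ ⟨⟨p', hp'⟩, c'⟩ h
      have h' : (c : K) • p.rep = (c' : K) • p'.rep := congrArg Subtype.val h
      obtain rfl : p = p' := by
        rw [← p.mk_rep, ← p'.mk_rep, Projectivization.mk_eq_mk_iff]
        exact ⟨c⁻¹ * c', by rw [mul_smul, inv_smul_eq_iff]; exact h'.symm⟩
      obtain rfl : c = c' := Units.ext (smul_left_injective K p.rep_nonzero h')
      rfl
    · rintro ⟨v, hv, hFv⟩
      obtain ⟨a, ha⟩ := Projectivization.exists_smul_eq_mk_rep K v hv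
      refine ⟨(⟨Projectivization.mk K v hv, ?_⟩, a⁻¹), Subtype.ext ?_⟩
      · rw [← ha, Units.smul_def, hsmul, hFv, mul_zero]
      · simp only [φ]
        rw [← ha, ← Units.smul_def, inv_smul_smul]
  rw [← Fintype.card_units, ← Nat.card_eq_fintype_card, ← Nat.card_prod, Nat.card_congr
    (Equiv.ofBijective φ hφ), Nat.card_eq_fintype_card, Fintype.card_subtype]
  have h0 : (0 : Fin n → K) ∈ Finset.univ.filter fun v => eval v F = 0 := by
    simpa [hd] using hsmul 0 0
  rw [← Finset.card_erase_add_one h0]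
  congr 2
  ext v
  simp

theorem exists_eval_ne_zero_of_not_dvd {F : MvPolynomial (Fin 4) K}
    (hF : F.IsHomogeneous (d + 1)) (hd : d + 1 ≤ Fintype.card K)
    (hnd : ¬ ∃ a : Fin 4 → K, a ≠ 0 ∧ linForm a ∣ F) {x y z : Fin 4 → K}
    (h : LinearIndependent K ![x, y, z]) : ∃ a b c : K, eval (a • x + b • y + c • z) F ≠ 0 := by
  by_contra! hc
  have hfr : Module.finrank K (Submodule.span K (Set.range ![x, y, z])) = 3 := by
    simpa using finrank_span_eq_card h
  obtain ⟨ψ, hψ, hle⟩ := Submodule.exists_le_ker_of_lt_top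
    (Submodule.span K (Set.range ![x, y, z])) (lt_top_iff_ne_top.2 fun h => by
      rw [h, finrank_top, Module.finrank_fin_fun] at hfr
      omega)
  have hker : Submodule.span K (Set.range ![x, y, z]) = LinearMap.ker ψ := by
    refine Submodule.eq_of_le_of_finrank_eq hle ?_
    have h1 := ψ.finrank_range_add_finrank_ker
    rw [LinearMap.range_eq_top.2 (LinearMap.surjective hψ), finrank_top, Module.finrank_self,
      Module.finrank_fin_fun] at h1
    omega
  obtain ⟨g, hg, hfg⟩ := (isForm_eval hF).exists_eq_mul hψ fun v hv => by
    have : v ∈ Submodule.span K (Set.range ![x, y, z]) := by rw [hker]; exact hv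
    obtain ⟨c, rfl⟩ := (Submodule.mem_span_range_iff_exists_fun K).1 this
    simpa [Fin.sum_univ_succ, ← add_assoc] using hc (c 0) (c 1) (c 2)
  obtain ⟨G, hG, hGg⟩ := hg.exists_polynomial
  refine hnd ⟨fun i => ψ (Pi.single i 1), fun h0 => hψ ?_, G, ?_⟩
  · refine LinearMap.ext fun v => ?_
    rw [← eval_linForm_single, h0]
    simp [eval_linForm]
  · refine eq_of_forall_eval_eq hF ?_ hd fun v => ?_
    · rw [add_comm]
      exact (isHomogeneous_linForm _).mul hG
    · rw [map_mul, eval_linForm_single, hGg, hfg]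

theorem isExtremalForm_eval [DecidableEq K] {m : ℕ} {F : MvPolynomial (Fin 4) K}
    (hF : F.IsHomogeneous (m + 1)) (hm : 1 ≤ m) (hlt : m < Fintype.card K)
    (hnd : ¬ ∃ a : Fin 4 → K, a ≠ 0 ∧ linForm a ∣ F)
    (hN : Nat.card {p : Projectivization K (Fin 4 → K) // eval p.rep F = 0} =
      m * Fintype.card K ^ 2 + (m + 1) * Fintype.card K + 1) :
    IsExtremalForm m fun v => eval v F where
  isForm := isForm_eval hF
  one_le := hm
  lt := hlt
  finrank_eq := by simp
  exists_ne _ _ _ h := exists_eval_ne_zero_of_not_dvd hF hlt hnd h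
  card_zeros := by
    rw [card_filter_eval hF (by omega), hN]
    obtain ⟨q, hq⟩ : ∃ q, Fintype.card K = q + 1 := ⟨Fintype.card K - 1, by omega⟩
    rw [hq, Nat.add_sub_cancel]
    ring

end Polynomials

section Symplectic

variable {V : Type} [AddCommGroup V] [Module K V]

theorem linearIndependent_of_symplectic {B : V →ₗ[K] V →ₗ[K] K} {e : Fin 4 → V}
    (h : ∀ i j, B (e i) (e j) = !![0, -1, 0, 0; 1, 0, 0, 0; 0, 0, 0, -1; 0, 0, 1, 0] i j) :
    LinearIndependent K e := by
  rw [Fintype.linearIndependent_iff]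
  intro c hc
  have hB : ∀ j, ∑ i, c i * B (e i) (e j) = 0 := fun j => by
    have := congrArg (fun v => B v (e j)) hc
    simpa only [map_sum, LinearMap.sum_apply, LinearMap.map_smul, LinearMap.smul_apply,
      smul_eq_mul, map_zero, LinearMap.zero_apply] using this
  simp only [h] at hB
  have h0 := hB 0
  have h1 := hB 1
  have h2 := hB 2
  have h3 := hB 3
  simp [Fin.sum_univ_four] at h0 h1 h2 h3
  intro i
  fin_cases i <;> assumption

/-- An alternating form is of rank at most two, or it has a hyperbolic system of length four. -/
theorem exists_symplectic_or_eq_wedge [Nontrivial V] {B : V →ₗ[K] V →ₗ[K] K} (hB : B.IsAlt) :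
    (∃ e : Fin 4 → V, ∀ i j,
      B (e i) (e j) = !![0, -1, 0, 0; 1, 0, 0, 0; 0, 0, 0, -1; 0, 0, 1, 0] i j) ∨
    ∃ α β : V →ₗ[K] K, α ≠ 0 ∧ ∀ x y, B x y = β x * α y - α x * β y := by
  have hexists : ∀ x y, B x y ≠ 0 → ∃ z, B z y = 1 := fun x y h =>
    ⟨(B x y)⁻¹ • x, by simp [h]⟩
  have hneg : ∀ x y, B x y = -B y x := fun x y => (hB.neg y x).symm
  by_cases h0 : ∃ x y, B x y ≠ 0
  swap
  · push Not at h0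
    obtain ⟨α, hα⟩ := exists_ne (0 : V →ₗ[K] K)
    exact .inr ⟨α, 0, hα, by simp [h0]⟩
  obtain ⟨x, u, hxu⟩ := h0
  obtain ⟨v, hvu⟩ := hexists x u hxu
  have huv : B u v = -1 := by rw [hneg, hvu]
  let π : V → V := fun x => x - B x u • v + B x v • u
  have hπu : ∀ x, B (π x) u = 0 := fun x => by simp [π, hvu, hB.self_eq_zero]
  have hπv : ∀ x, B (π x) v = 0 := fun x => by simp [π, huv, hB.self_eq_zero]
  by_cases h1 : ∃ x y, B (π x) (π y) ≠ 0
  · obtain ⟨x, y, hxy⟩ := h1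
    obtain ⟨c, hc⟩ : ∃ c, c * B (π x) (π y) = 1 := ⟨_, inv_mul_cancel₀ hxy⟩
    refine .inl ⟨![u, v, π y, c • π x], fun i j => ?_⟩
    have hu : ∀ x, B u (π x) = 0 := fun x => by rw [hneg, hπu, neg_zero]
    have hv : ∀ x, B v (π x) = 0 := fun x => by rw [hneg, hπv, neg_zero]
    have hyx : c * B (π y) (π x) = -1 := by rw [hneg, mul_neg, hc]
    fin_cases i <;> fin_cases j <;>
      simp [hvu, huv, hB.self_eq_zero, hπu, hπv, hu, hv, hc, hyx]
  · push Not at h1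
    refine .inr ⟨B.flip u, B.flip v, fun h => ?_, fun x y => ?_⟩
    · simpa [hvu] using LinearMap.congr_fun h v
    · have := h1 x y
      simp [π, hvu, huv, hB.self_eq_zero, hneg u y, hneg v y] at this
      simp
      linear_combination this

end Symplectic

section Vanishing

variable {n d : ℕ}

/-- The restriction of a polynomial to the line through `x` in direction `y`. -/
noncomputable def restrictLine (x y : Fin n → K) (F : MvPolynomial (Fin n) K) : Polynomial K :=
  aeval (fun i => Polynomial.C (y i) * Polynomial.X + Polynomial.C (x i)) F

theorem eval_restrictLine (x y : Fin n → K) (F : MvPolynomial (Fin n) K) (t : K) :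
    (restrictLine x y F).eval t = eval (x + t • y) F := by
  induction F using MvPolynomial.induction_on with
  | C a => simp [restrictLine]
  | add F G hF hG => simpa [restrictLine] using congrArg₂ (· + ·) hF hG
  | mul_X F i hF =>
    rw [restrictLine] at hF ⊢
    rw [map_mul, aeval_X, Polynomial.eval_mul, hF]
    simp [-mul_eq_mul_left_iff, mul_comm t, add_comm]

theorem derivative_restrictLine (x y : Fin n → K) (F : MvPolynomial (Fin n) K) :
    (restrictLine x y F).derivative =
      ∑ i, Polynomial.C (y i) * restrictLine x y (pderiv i F) := by
  induction F using MvPolynomial.induction_on with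
  | C a => simp [restrictLine]
  | add F G hF hG =>
    simp only [restrictLine, map_add] at hF hG ⊢
    simp only [hF, hG, mul_add, Finset.sum_add_distrib]
  | mul_X F i hF =>
    have hmul : ∀ G H, restrictLine x y (G * H) = restrictLine x y G * restrictLine x y H :=
      map_mul _
    have hterm : ∀ j, Polynomial.C (y j) * restrictLine x y (pderiv j (F * X i)) =
        (if i = j then Polynomial.C (y j) * restrictLine x y F else 0) +
          Polynomial.C (y j) * restrictLine x y (pderiv j F) * restrictLine x y (X i) := by
      intro j
      simp only [Derivation.leibniz, pderiv_X, smul_eq_mul]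
      split_ifs with h
      · subst h
        simp [restrictLine]
        ring
      · simp [restrictLine, h]
        ring
    rw [hmul, Polynomial.derivative_mul, hF, Finset.sum_congr rfl fun j _ => hterm j,
      Finset.sum_add_distrib, Finset.sum_ite_eq, if_pos (Finset.mem_univ i), Finset.sum_mul,
      add_comm]
    simp only [restrictLine, aeval_X, Polynomial.derivative_add, Polynomial.derivative_C_mul,
      Polynomial.derivative_X, Polynomial.derivative_C]
    ring

theorem natDegree_restrictLine_le {F : MvPolynomial (Fin n) K} (hF : F.IsHomogeneous d)
    (x y : Fin n → K) :
    (restrictLine x y F).natDegree ≤ d ∧ (restrictLine x y F).coeff d = eval y F := by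
  have key : ∀ (s : Fin n →₀ ℕ) (t : Finset (Fin n)),
      (∏ i ∈ t, (Polynomial.C (y i) * Polynomial.X + Polynomial.C (x i)) ^ s i).natDegree ≤
        ∑ i ∈ t, s i ∧
      (∏ i ∈ t, (Polynomial.C (y i) * Polynomial.X + Polynomial.C (x i)) ^ s i).coeff
        (∑ i ∈ t, s i) = ∏ i ∈ t, y i ^ s i := by
    intro s t
    induction t using Finset.induction_on with
    | empty => simp
    | insert i t hi ih =>
      simp only [Finset.prod_insert hi, Finset.sum_insert hi]
      have h1 : (Polynomial.C (y i) * Polynomial.X + Polynomial.C (x i)).natDegree ≤ 1 :=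
        Polynomial.natDegree_linear_le
      have h2 := Polynomial.natDegree_pow_le_of_le (s i) h1
      have h3 := Polynomial.coeff_pow_of_natDegree_le (m := s i) h1
      rw [mul_one] at h2 h3
      refine ⟨Polynomial.natDegree_mul_le_of_le h2 ih.1, ?_⟩
      rw [Polynomial.coeff_mul_add_eq_of_natDegree_le h2 ih.1, ih.2, h3]
      simp
  have hsum : restrictLine x y F = ∑ s ∈ F.support, Polynomial.C (coeff s F) *
      ∏ i ∈ s.support, (Polynomial.C (y i) * Polynomial.X + Polynomial.C (x i)) ^ s i := by
    rw [restrictLine, aeval_def, eval₂_eq]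
    rfl
  rw [hsum]
  constructor
  · refine Polynomial.natDegree_sum_le_of_forall_le _ _ fun s hs => ?_
    obtain rfl := hF.degree_eq_sum_deg_support hs
    exact (Polynomial.natDegree_C_mul_le _ _).trans (key s _).1
  · rw [Polynomial.finsetSum_coeff, eval_eq]
    refine Finset.sum_congr rfl fun s hs => ?_
    obtain rfl := hF.degree_eq_sum_deg_support hs
    rw [Polynomial.coeff_C_mul, (key s _).2]

variable [Fintype K]

theorem Polynomial.derivative_eq_C_of_forall_eval {p : Polynomial K}
    (hp : p.natDegree ≤ Fintype.card K) (h : ∀ t, p.eval t = 0) :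
    ∃ c, p.derivative = Polynomial.C c := by
  have hq := Fintype.one_lt_card (α := K)
  have hX := FiniteField.X_pow_card_sub_X_natDegree_eq K hq
  have hX' : (Polynomial.X ^ Fintype.card K - Polynomial.X : Polynomial K).coeff
      (Fintype.card K) = 1 := by
    simp [Polynomial.coeff_X, hq.ne]
  set r := p - Polynomial.C (p.coeff (Fintype.card K)) *
    (Polynomial.X ^ Fintype.card K - Polynomial.X) with hr
  have hr0 : r = 0 := by
    refine Polynomial.eq_zero_of_forall_eval ?_ fun t => by simp [hr, h, FiniteField.pow_card]
    refine (Polynomial.natDegree_le_pred (n := Fintype.card K) ?_ ?_).trans_lt (by omega)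
    · exact (Polynomial.natDegree_sub_le _ _).trans
        (max_le hp ((Polynomial.natDegree_C_mul_le _ _).trans hX.le))
    · rw [Polynomial.coeff_sub, Polynomial.coeff_C_mul, hX', mul_one, sub_self]
  refine ⟨-p.coeff (Fintype.card K), ?_⟩
  rw [sub_eq_zero.1 (hr.symm.trans hr0), Polynomial.derivative_C_mul, Polynomial.derivative_sub,
    Polynomial.derivative_X_pow, FiniteField.cast_card_eq_zero, ← sub_eq_zero.1
    (hr.symm.trans hr0)]
  simp

/-- The differential of a form of degree `q + 1` with no nonzero values is alternating. -/
theorem exists_isAlt_of_forall_eval_eq_zero {F : MvPolynomial (Fin n) K}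
    (hF : F.IsHomogeneous (Fintype.card K + 1)) (h : ∀ v, eval v F = 0) :
    ∃ B : (Fin n → K) →ₗ[K] (Fin n → K) →ₗ[K] K, B.IsAlt ∧
      ∀ x y, B x y = ∑ i, y i * eval x (pderiv i F) := by
  set D : (Fin n → K) → (Fin n → K) → K := fun x y => ∑ i, y i * eval x (pderiv i F) with hD
  have hadd : ∀ x y z, D x (y + z) = D x y + D x z := by
    simp [hD, add_mul, Finset.sum_add_distrib]
  have hsmul : ∀ (c : K) x y, D x (c • y) = c * D x y := by
    simp [hD, Finset.mul_sum, mul_assoc]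
  have hself : ∀ x, D x x = 0 := fun x => by
    have := congrArg (eval x) hF.sum_X_mul_pderiv
    simpa [hD, h] using this
  have htranslate : ∀ x y, D (x + y) y = D x y := fun x y => by
    obtain ⟨hdeg, hcoeff⟩ := natDegree_restrictLine_le hF x y
    rw [h] at hcoeff
    obtain ⟨c, hc⟩ := Polynomial.derivative_eq_C_of_forall_eval
      (Polynomial.natDegree_le_pred hdeg hcoeff)
      fun t => by rw [eval_restrictLine, h]
    rw [derivative_restrictLine] at hc
    have hval : ∀ t : K, D (x + t • y) y = c := fun t => by
      simpa [Polynomial.eval_finsetSum, eval_restrictLine] using congrArg (Polynomial.eval t) hc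
    have h1 := hval 1
    have h0 := hval 0
    rw [one_smul] at h1
    rw [zero_smul, add_zero] at h0
    rw [h0, h1]
  have hswap : ∀ x y, D x y = -D y x := fun x y => by
    have h1 := hself (x + y)
    rw [hadd, htranslate, add_comm x y, htranslate] at h1
    linear_combination h1
  exact ⟨LinearMap.mk₂ K D (fun x y z => by rw [hswap, hadd, neg_add, ← hswap, ← hswap])
    (fun c x y => by rw [hswap, hsmul, ← mul_neg, ← hswap, smul_eq_mul]) (fun x => hadd x)
    (fun c x => hsmul c x), hself, fun _ _ => rfl⟩

theorem sum_X_mul_pderiv_of_card_add_one {F : MvPolynomial (Fin n) K}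
    (hF : F.IsHomogeneous (Fintype.card K + 1)) : ∑ i, X i * pderiv i F = F := by
  have h : ((Fintype.card K : ℕ) : MvPolynomial (Fin n) K) = 0 := by
    rw [← map_natCast (C : K →+* MvPolynomial (Fin n) K), FiniteField.cast_card_eq_zero, map_zero]
  rw [hF.sum_X_mul_pderiv, nsmul_eq_mul, Nat.cast_succ, h, zero_add, one_mul]

/-- A form of degree `q + 1` with no nonzero values, in a basis, in terms of the Gram matrix of
its differential. -/
theorem substLin_eq_sum {F : MvPolynomial (Fin n) K}
    (hF : F.IsHomogeneous (Fintype.card K + 1))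
    {B : (Fin n → K) →ₗ[K] (Fin n → K) →ₗ[K] K}
    (hB : ∀ x y, B x y = ∑ i, y i * eval x (pderiv i F)) (e : Fin n → Fin n → K) :
    substLin (Matrix.of e).transpose F =
      ∑ j, X j * ∑ i, C (B (e i) (e j)) * X i ^ Fintype.card K := by
  set M := (Matrix.of e).transpose with hM
  have hP : ∀ j, ∑ i, C (e j i) * substLin M (pderiv i F) =
      ∑ i, C (B (e i) (e j)) * X i ^ Fintype.card K := fun j => by
    refine eq_of_forall_eval_eq (d := Fintype.card K) ?_ ?_ le_rfl fun v => ?_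
    · exact IsHomogeneous.sum _ _ _ fun i _ =>
        (isHomogeneous_substLin (by simpa using hF.pderiv) M).C_mul _
    · exact IsHomogeneous.sum _ _ _ fun i _ => (isHomogeneous_X_pow _ _).C_mul _
    · have hv : M.mulVec v = ∑ i, v i • e i := by
        ext i
        simp [hM, Matrix.mulVec, dotProduct, mul_comm]
      have h1 := hB (M.mulVec v) (e j)
      rw [hv] at h1
      simp only [map_sum, map_mul, eval_C, eval_substLin, map_pow, eval_X, FiniteField.pow_card,
        hv, ← h1, LinearMap.sum_apply, LinearMap.map_smul, LinearMap.smul_apply, smul_eq_mul,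
        mul_comm]
  conv_lhs => rw [← sum_X_mul_pderiv_of_card_add_one hF]
  simp only [← hP, Finset.mul_sum]
  rw [Finset.sum_comm]
  simp only [substLin, map_sum, map_mul, aeval_X, Finset.sum_mul]
  refine Finset.sum_congr rfl fun i _ => Finset.sum_congr rfl fun j _ => ?_
  rw [hM, Matrix.transpose_apply, Matrix.of_apply]
  ring

theorem projEquiv_of_forall_eval_eq_zero {F : MvPolynomial (Fin 4) K}
    (hF : F.IsHomogeneous (Fintype.card K + 1)) (h : ∀ v, eval v F = 0)
    (hnd : ¬ ∃ a : Fin 4 → K, a ≠ 0 ∧ linForm a ∣ F) :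
    ProjEquiv F (X 0 * X 1 ^ Fintype.card K - X 0 ^ Fintype.card K * X 1 +
      X 2 * X 3 ^ Fintype.card K - X 2 ^ Fintype.card K * X 3) := by
  obtain ⟨B, hB, hBF⟩ := exists_isAlt_of_forall_eval_eq_zero hF h
  obtain ⟨e, he⟩ | ⟨α, β, hα, hαβ⟩ := exists_symplectic_or_eq_wedge hB
  · refine ⟨(Matrix.of e).transpose, ?_, 1, one_ne_zero, ?_⟩
    · rw [Matrix.det_transpose, ← Matrix.isUnit_iff_isUnit_det,
        ← Matrix.linearIndependent_rows_iff_isUnit]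
      exact linearIndependent_of_symplectic he
    · rw [substLin_eq_sum hF hBF e]
      simp [he, Fin.sum_univ_four]
      ring
  · refine absurd ⟨fun i => α (Pi.single i 1), fun h0 => hα ?_, ?_⟩ hnd
    · refine LinearMap.ext fun v => ?_
      rw [← eval_linForm_single, h0]
      simp [eval_linForm]
    · set a := fun i => α (Pi.single i 1) with ha
      set b := fun i => β (Pi.single i 1) with hb
      have hpd : ∀ i, pderiv i F =
          C (a i) * linForm b ^ Fintype.card K - C (b i) * linForm a ^ Fintype.card K := fun i => by
        refine eq_of_forall_eval_eq (d := Fintype.card K) (by simpa using hF.pderiv) ?_ le_rfl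
          fun v => ?_
        · have := fun c : Fin 4 → K => (isHomogeneous_linForm c).pow (Fintype.card K)
          simp only [one_mul] at this
          exact ((this b).C_mul _).sub ((this a).C_mul _)
        · have h1 := hBF v (Pi.single i 1)
          rw [hαβ] at h1
          simp only [Pi.single_apply, ite_mul, one_mul, zero_mul, Finset.sum_ite_eq',
            Finset.mem_univ, if_true] at h1
          rw [← h1, map_sub, map_mul, map_mul, map_pow, map_pow, eval_C, eval_C, hb, ha,
            eval_linForm_single, eval_linForm_single, FiniteField.pow_card, FiniteField.pow_card]
          ring
      have hF' : F = linForm a * linForm b ^ Fintype.card K -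
          linForm b * linForm a ^ Fintype.card K := by
        conv_lhs => rw [← sum_X_mul_pderiv_of_card_add_one hF]
        simp only [hpd, mul_sub, Finset.sum_sub_distrib, ← mul_assoc, ← Finset.sum_mul]
        simp only [linForm, mul_comm]
      rw [hF']
      exact dvd_sub (dvd_mul_right _ _)
        (dvd_mul_of_dvd_right (dvd_pow_self _ Fintype.card_ne_zero) _)

end Vanishing

/-- A surface of degree `d` (`2 ≤ d ≤ q+1`) in `P^3` over `F_q` without
`F_q`-plane components attaining the elementary bound `N_q(S) = (d-1)q² + dq + 1` is
projectively equivalent over `F_q` to: (i) the hyperbolic quadric `X₀X₁ - X₂X₃ = 0` if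
`d = 2`; (ii) the Hermitian surface `X₀^{√q+1} + X₁^{√q+1} + X₂^{√q+1} + X₃^{√q+1} = 0`
if `d = √q + 1` (`q` a square); (iii) `X₀X₁^q - X₀^qX₁ + X₂X₃^q - X₂^qX₃ = 0` if
`d = q + 1`. -/
theorem classification_of_extremal_surfaces (K : Type) [Field K] [Fintype K]
    (d : ℕ) (F : MvPolynomial (Fin 4) K)
    (hhom : F.IsHomogeneous d) (hsf : Squarefree F)
    (hnoplane : ¬ ∃ a : Fin 4 → K, a ≠ 0 ∧ linForm a ∣ F)
    (hd2 : 2 ≤ d) (hdq : d ≤ Fintype.card K + 1)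
    (hN : Nat.card {p : Projectivization K (Fin 4 → K) // MvPolynomial.eval p.rep F = 0} =
      (d - 1) * Fintype.card K ^ 2 + d * Fintype.card K + 1) :
    (d = 2 ∧ ProjEquiv F (X 0 * X 1 - X 2 * X 3 : MvPolynomial (Fin 4) K)) ∨
    (∃ m : ℕ, Fintype.card K = m ^ 2 ∧ d = m + 1 ∧
      ProjEquiv F (X 0 ^ (m + 1) + X 1 ^ (m + 1) + X 2 ^ (m + 1) + X 3 ^ (m + 1) :
        MvPolynomial (Fin 4) K)) ∨
    (d = Fintype.card K + 1 ∧
      ProjEquiv F (X 0 * X 1 ^ Fintype.card K - X 0 ^ Fintype.card K * X 1 +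
        X 2 * X 3 ^ Fintype.card K - X 2 ^ Fintype.card K * X 3 :
        MvPolynomial (Fin 4) K)) := by
  classical
  obtain rfl | hlt : d = Fintype.card K + 1 ∨ d ≤ Fintype.card K := by omega
  · refine .inr (.inr ⟨rfl, projEquiv_of_forall_eval_eq_zero hhom (fun v => ?_) hnoplane⟩)
    have hcard := card_filter_eval hhom (Nat.succ_ne_zero _)
    rw [hN] at hcard
    have huniv : (Finset.univ.filter fun v => eval v F = 0).card =
        (Finset.univ : Finset (Fin 4 → K)).card := by
      rw [hcard, Finset.card_univ, Fintype.card_pi_const, Nat.add_sub_cancel]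
      obtain ⟨q, hq⟩ : ∃ q, Fintype.card K = q + 1 := ⟨Fintype.card K - 1, by omega⟩
      rw [hq, Nat.add_sub_cancel]
      ring
    have hv := Finset.mem_univ v
    rw [← Finset.eq_of_subset_of_card_le (Finset.subset_univ _) huniv.ge] at hv
    exact (Finset.mem_filter.1 hv).2
  · obtain ⟨m, rfl⟩ : ∃ m, d = m + 1 := ⟨d - 1, by omega⟩
    rw [Nat.add_sub_cancel] at hN
    have hF := isExtremalForm_eval hhom (by omega) hlt hnoplane hN
    obtain rfl | hm : m = 1 ∨ 2 ≤ m := by omega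
    · obtain ⟨e, he, h⟩ := hF.exists_quadric_basis
      refine .inl ⟨rfl, projEquiv_of_eval hhom ?_ hlt he one_ne_zero fun x => by simp [h]⟩
      exact ((isHomogeneous_X _ _).mul (isHomogeneous_X _ _)).sub
        ((isHomogeneous_X _ _).mul (isHomogeneous_X _ _))
    · obtain ⟨hcard, e, ρ, he, hρ, h⟩ := hF.exists_hermitian_basis hm
      refine .inr (.inl ⟨m, hcard, rfl, projEquiv_of_eval hhom ?_ hlt he hρ fun x => by simp [h]⟩)
      exact (((isHomogeneous_X_pow _ _).add (isHomogeneous_X_pow _ _)).add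
        (isHomogeneous_X_pow _ _)).add (isHomogeneous_X_pow _ _)
end

section
/- Let S be a surface of degree q+1 in P^3 over F_q without F_q-plane components such that S(F_q) = P^3(F_q), i.e., the defining form vanishes at every F_q-point of P^3. Then S is projectively equivalent over F_q to the surface X_0X_1^q − X_0^qX_1 + X_2X_3^q − X_2^qX_3 = 0. -/
open MvPolynomial

variable {K : Type} [Field K]

/-- The form `∑ Aᵢⱼ Xᵢ Xⱼ ^ q`. -/
noncomputable def frobForm (q : ℕ) {n : ℕ} (A : Matrix (Fin n) (Fin n) K) :
    MvPolynomial (Fin n) K :=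
  ∑ i, ∑ j, C (A i j) * (X i * X j ^ q)

theorem single_one_add_single_injective {σ : Type*} {q : ℕ} (hq : 2 ≤ q) {i j i' j' : σ}
    (h : Finsupp.single i 1 + Finsupp.single j q = Finsupp.single i' 1 + Finsupp.single j' q) :
    i = i' ∧ j = j' := by
  classical
  have hj : j = j' := by
    by_contra hne
    have := DFunLike.congr_fun h j
    simp only [Finsupp.add_apply, Finsupp.single_apply] at this
    grind
  subst hj
  exact ⟨by simpa [Finsupp.single_left_inj] using h, rfl⟩

theorem exists_eq_single_one_add_single {n : ℕ} {q : ℕ} {m : Fin n →₀ ℕ}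
    (hm : m.degree = q + 1) {j : Fin n} (hj : q ≤ m j) :
    ∃ i, m = Finsupp.single i 1 + Finsupp.single j q := by
  have hle : Finsupp.single j q ≤ m := by simpa using hj
  obtain ⟨r, rfl⟩ := exists_add_of_le hle
  have hr : r.degree = 1 := by
    rw [map_add, Finsupp.degree_single] at hm
    omega
  obtain ⟨i, hi⟩ : ∃ i, r i ≠ 0 := by
    by_contra! h
    simp [show r = 0 from Finsupp.ext h] at hr
  have hle' : Finsupp.single i 1 ≤ r := by simpa [Nat.one_le_iff_ne_zero] using hi
  obtain ⟨s, rfl⟩ := exists_add_of_le hle'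
  obtain rfl : s = 0 := by
    rw [map_add, Finsupp.degree_single] at hr
    exact (Finsupp.degree_eq_zero_iff s).1 (by omega)
  rw [add_zero]
  exact ⟨i, add_comm _ _⟩

theorem X_mul_X_pow_eq_monomial {σ : Type*} (q : ℕ) (i j : σ) (a : K) :
    (C a * (X i * X j ^ q) : MvPolynomial σ K) =
      monomial (Finsupp.single i 1 + Finsupp.single j q) a := by
  rw [X_pow_eq_monomial, X, monomial_mul, C_mul_monomial]
  simp

theorem coeff_frobForm {q : ℕ} (hq : 2 ≤ q) {n : ℕ} (A : Matrix (Fin n) (Fin n) K)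
    (i j : Fin n) :
    coeff (Finsupp.single i 1 + Finsupp.single j q) (frobForm q A) = A i j := by
  simp only [frobForm, X_mul_X_pow_eq_monomial, coeff_sum]
  rw [Finset.sum_eq_single i, Finset.sum_eq_single j]
  · simp
  · intro j' _ hne
    rw [coeff_monomial, if_neg]
    exact fun h => hne (single_one_add_single_injective hq h).2
  · simp
  · intro i' _ hne
    refine Finset.sum_eq_zero fun j' _ => ?_
    rw [coeff_monomial, if_neg]
    exact fun h => hne (single_one_add_single_injective hq h).1
  · simp

theorem isHomogeneous_frobForm (q : ℕ) {n : ℕ} (A : Matrix (Fin n) (Fin n) K) :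
    (frobForm q A).IsHomogeneous (q + 1) := by
  refine IsHomogeneous.sum _ _ _ fun i _ => IsHomogeneous.sum _ _ _ fun j _ => ?_
  rw [X_mul_X_pow_eq_monomial]
  exact isHomogeneous_monomial _ (by simp [add_comm])

theorem eval_frobForm (q : ℕ) {n : ℕ} (A : Matrix (Fin n) (Fin n) K) (v : Fin n → K) :
    eval v (frobForm q A) = ∑ i, ∑ j, A i j * (v i * v j ^ q) := by
  simp [frobForm]

/-- A homogeneous polynomial of degree `q + 1` vanishing at every `F_q`-point has the form
`∑ Aᵢⱼ Xᵢ Xⱼ ^ q`. -/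
theorem exists_eq_frobForm [Fintype K] {n : ℕ} {F : MvPolynomial (Fin n) K}
    (hhom : F.IsHomogeneous (Fintype.card K + 1)) (hall : ∀ v, eval v F = 0) :
    ∃ A : Matrix (Fin n) (Fin n) K, F = frobForm (Fintype.card K) A := by
  set q := Fintype.card K with hqdef
  have hq : 2 ≤ q := Fintype.one_lt_card
  let A : Matrix (Fin n) (Fin n) K :=
    fun i j => coeff (Finsupp.single i 1 + Finsupp.single j q) F
  refine ⟨A, ?_⟩
  set H := F - frobForm q A with hHdef
  have hH : H.IsHomogeneous (q + 1) := hhom.sub (isHomogeneous_frobForm q A)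
  have hHdeg : ∀ m ∈ H.support, ∀ j, m j ≤ q - 1 := by
    intro m hm j
    by_contra hlt
    have hmd : m.degree = q + 1 := by
      by_contra hne
      exact mem_support_iff.1 hm (hH.coeff_eq_zero hne)
    obtain ⟨i, rfl⟩ := exists_eq_single_one_add_single hmd (j := j) (by omega)
    refine mem_support_iff.1 hm ?_
    rw [hHdef, coeff_sub, coeff_frobForm hq, sub_self]
  have hquad : ∀ v, eval v H + ∑ i, ∑ j, A i j * (v i * v j) = 0 := by
    intro v
    rw [hHdef, map_sub, hall, eval_frobForm]
    simp [hqdef, FiniteField.pow_card]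
  have hdiag : ∀ i, A i i = 0 := by
    intro i
    have h0 : eval (Pi.single i 1) H = 0 := by
      rw [eval_eq]
      refine Finset.sum_eq_zero fun m hm => ?_
      obtain ⟨k, hk, hmk⟩ : ∃ k, k ≠ i ∧ m k ≠ 0 := by
        by_contra! hcon
        have hmd : m.degree = q + 1 := by
          by_contra hne
          exact mem_support_iff.1 hm (hH.coeff_eq_zero hne)
        rw [Finsupp.degree_eq_sum, Finset.sum_eq_single i (fun k _ hk => hcon k hk) (by simp)] at hmd
        have := hHdeg m hm i
        omega
      rw [Finset.prod_eq_zero (i := k) (by simpa using hmk), mul_zero]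
      simp [hk, hmk]
    have := hquad (Pi.single i 1)
    simpa [h0, Pi.single_apply] using this
  have hR : H + frobForm 1 A = 0 := by
    refine eq_zero_of_eval_eq_zero (Fin n) K _ (fun v => ?_) ?_
    · rw [map_add, eval_frobForm]
      simpa using hquad v
    · refine Submodule.add_mem _ ((mem_restrictDegree _ _ _).2 hHdeg)
        (Submodule.sum_mem _ fun i _ => Submodule.sum_mem _ fun j _ => ?_)
      rcases eq_or_ne i j with rfl | hij
      · simp [hdiag]
      · rw [X_mul_X_pow_eq_monomial, mem_restrictDegree]
        intro m hm k
        rw [Finset.mem_singleton.1 (support_monomial_subset hm)]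
        simp only [Finsupp.add_apply, Finsupp.single_apply]
        grind
  have hH0 : H = 0 := by
    have h1 := congrArg (homogeneousComponent (q + 1)) hR
    rw [map_add, homogeneousComponent_of_mem hH,
      homogeneousComponent_of_mem (isHomogeneous_frobForm 1 A), if_pos rfl, if_neg (by omega)] at h1
    simpa using h1
  exact sub_eq_zero.1 hH0

theorem frobForm_eq_dotProduct (q : ℕ) {n : ℕ} (A : Matrix (Fin n) (Fin n) K) :
    frobForm q A = X ⬝ᵥ (A.map C).mulVec (fun j => X j ^ q) := by
  simp [frobForm, dotProduct, Matrix.mulVec, Finset.mul_sum, mul_left_comm]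

theorem sum_mul_X_pow_card [Fintype K] {n : ℕ} (b : Fin n → K) :
    (∑ j, C (b j) * X j : MvPolynomial (Fin n) K) ^ Fintype.card K =
      ∑ j, C (b j) * X j ^ Fintype.card K := by
  obtain ⟨p, hp⟩ := CharP.exists K
  obtain ⟨⟨m, hm⟩, hprime, hcard⟩ := FiniteField.card K p
  have : Fact p.Prime := ⟨hprime⟩
  have hC : ∀ j, C (b j) ^ p ^ m = (C (b j) : MvPolynomial (Fin n) K) := by
    intro j
    rw [← C_pow, ← show Fintype.card K = p ^ m from hcard, FiniteField.pow_card]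
  rw [show Fintype.card K = p ^ m from hcard, sum_pow_char_pow]
  simp [mul_pow, hC]

theorem substLin_frobForm [Fintype K] {n : ℕ} (A M : Matrix (Fin n) (Fin n) K) :
    substLin M (frobForm (Fintype.card K) A) =
      frobForm (Fintype.card K) (M.transpose * A * M) := by
  have hX : ∀ i, substLin M (X i) = (M.map C).mulVec X i := by
    intro i
    simp [substLin, Matrix.mulVec, dotProduct]
  have hXq : ∀ i, substLin M (X i) ^ Fintype.card K =
      (M.map C).mulVec (fun j => X j ^ Fintype.card K) i := by
    intro i
    simp [substLin, Matrix.mulVec, dotProduct, sum_mul_X_pow_card]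
  have hsub : substLin M (frobForm (Fintype.card K) A) =
      (M.map C).mulVec X ⬝ᵥ
        (A.map C).mulVec ((M.map C).mulVec fun j => X j ^ Fintype.card K) := by
    simp only [dotProduct, ← hX, Matrix.mulVec.eq_1 (A.map C), ← hXq, Finset.mul_sum,
      Matrix.map_apply]
    simp [substLin, frobForm, mul_left_comm]
  rw [hsub, frobForm_eq_dotProduct, Matrix.map_mul, Matrix.map_mul, Matrix.transpose_map,
    ← Matrix.mulVec_mulVec, ← Matrix.mulVec_mulVec, Matrix.dotProduct_mulVec X,
    Matrix.vecMul_transpose]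

theorem substLin_substLin {n : ℕ} (M N : Matrix (Fin n) (Fin n) K)
    (F : MvPolynomial (Fin n) K) : substLin N (substLin M F) = substLin (M * N) F := by
  simp only [substLin]
  rw [← AlgHom.comp_apply, comp_aeval]
  congr 2
  funext i
  simp only [map_sum, map_mul, aeval_X, aeval_C, algebraMap_eq, Matrix.mul_apply,
    Finset.mul_sum, Finset.sum_mul]
  rw [Finset.sum_comm]
  simp [mul_assoc]

theorem substLin_one {n : ℕ} (F : MvPolynomial (Fin n) K) : substLin 1 F = F := by
  simp [substLin, Matrix.one_apply]

theorem exists_linForm_dvd_of_X_dvd_substLin {n : ℕ} {M : Matrix (Fin n) (Fin n) K}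
    (hM : IsUnit M.det) {F : MvPolynomial (Fin n) K} {i : Fin n} (h : X i ∣ substLin M F) :
    ∃ a : Fin n → K, a ≠ 0 ∧ linForm a ∣ F := by
  refine ⟨M⁻¹ i, fun h0 => ?_, ?_⟩
  · have h1 := congrFun (congrFun (M.nonsing_inv_mul hM) i) i
    simp [Matrix.mul_apply, h0] at h1
  · have h1 : substLin M⁻¹ (X i) ∣ substLin M⁻¹ (substLin M F) := map_dvd (aeval _) h
    rwa [substLin_substLin, M.mul_nonsing_inv hM, substLin_one, substLin, aeval_X] at h1

/-- An alternating bilinear form on `K⁴` is zero, or is represented in a suitable basis by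
a standard block and a multiple of a standard block. -/
theorem exists_alternating_normal_form {A : Matrix (Fin 4) (Fin 4) K}
    (hA : ∀ v : Fin 4 → K, v ⬝ᵥ A.mulVec v = 0) (hA0 : A ≠ 0) :
    ∃ M : Matrix (Fin 4) (Fin 4) K, IsUnit M.det ∧ ∃ c : K, (c = 0 ∨ c = 1) ∧
      M.transpose * A * M = !![0, 1, 0, 0; -1, 0, 0, 0; 0, 0, 0, c; 0, 0, -c, 0] := by
  let B := Matrix.toBilin' A
  have hB : ∀ v w, B v w = v ⬝ᵥ A.mulVec w := Matrix.toBilin'_apply' A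
  have hBalt : B.IsAlt := fun v => by rw [hB, hA]
  have hBneg : ∀ v w, B w v = - B v w := fun v w => (LinearMap.BilinForm.IsAlt.neg_eq hBalt v w).symm
  obtain ⟨u, v, huv⟩ : ∃ u v, B u v = 1 := by
    obtain ⟨i, j, hij⟩ : ∃ i j, A i j ≠ 0 := by
      by_contra! h
      exact hA0 (by ext i j; exact h i j)
    refine ⟨Pi.single i 1, (A i j)⁻¹ • Pi.single j 1, ?_⟩
    simp [B, Matrix.toBilin'_single, hij]
  let f : (Fin 4 → K) →ₗ[K] (K × K) := (B u).prod (B v)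
  have hdim : 2 ≤ Module.finrank K (LinearMap.ker f) := by
    have h1 := f.finrank_range_add_finrank_ker
    have h2 : Module.finrank K (LinearMap.range f) ≤ 2 := by
      simpa using Submodule.finrank_le (LinearMap.range f)
    simp at h1
    omega
  obtain ⟨g, hg⟩ := exists_linearIndependent_of_le_finrank hdim
  obtain ⟨w, z, hwz, hw, hz, hc⟩ : ∃ w z : Fin 4 → K, LinearIndependent K ![w, z] ∧
      f w = 0 ∧ f z = 0 ∧ (B w z = 0 ∨ B w z = 1) := by
    have hind : LinearIndependent K ![(g 0 : Fin 4 → K), (g 1 : Fin 4 → K)] := by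
      have := hg.map' (LinearMap.ker f).subtype (Submodule.ker_subtype _)
      rwa [show ![(g 0 : Fin 4 → K), (g 1 : Fin 4 → K)] = (LinearMap.ker f).subtype ∘ g by
        funext i
        fin_cases i <;> rfl]
    by_cases h0 : B (g 0) (g 1) = 0
    · exact ⟨g 0, g 1, hind, (g 0).2, (g 1).2, Or.inl h0⟩
    · refine ⟨g 0, (B (g 0) (g 1))⁻¹ • g 1, ?_, (g 0).2, by simp, Or.inr (by simp [h0])⟩
      rw [LinearIndependent.pair_iff] at hind ⊢
      intro s t hst
      rw [smul_smul] at hst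
      have := hind _ _ hst
      simpa [h0] using this
  have huw : B u w = 0 := congrArg Prod.fst hw
  have hvw : B v w = 0 := congrArg Prod.snd hw
  have huz : B u z = 0 := congrArg Prod.fst hz
  have hvz : B v z = 0 := congrArg Prod.snd hz
  let N : Matrix (Fin 4) (Fin 4) K := ![u, v, w, z]
  have hN : LinearIndependent K N.row := by
    rw [Fintype.linearIndependent_iff]
    intro s hs
    have hs' : s 0 • u + s 1 • v + s 2 • w + s 3 • z = 0 := by
      simpa [Fin.sum_univ_four, N, Matrix.row] using hs
    have h1 : s 1 = 0 := by
      have := congrArg (B u) hs'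
      simpa [hBalt u, huv, huw, huz] using this
    have h0 : s 0 = 0 := by
      have := congrArg (B v) hs'
      simpa [hBalt v, hBneg u v, huv, hvw, hvz] using this
    have h23 := LinearIndependent.pair_iff.1 hwz (s 2) (s 3) (by simpa [h0, h1] using hs')
    intro i
    fin_cases i
    exacts [h0, h1, h23.1, h23.2]
  refine ⟨N.transpose, ?_, B w z, hc, ?_⟩
  · rw [Matrix.det_transpose]
    exact (Matrix.isUnit_iff_isUnit_det N).1 (Matrix.linearIndependent_rows_iff_isUnit.1 hN)
  · have hent : ∀ i j, (N.transpose.transpose * A * N.transpose) i j = B (N i) (N j) := by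
      intro i j
      simp only [hB, Matrix.mul_apply, Matrix.transpose_apply, dotProduct, Matrix.mulVec,
        Finset.sum_mul, Finset.mul_sum, mul_assoc]
      exact Finset.sum_comm
    ext i j
    rw [hent]
    fin_cases i <;> fin_cases j <;>
      simp [N, hBalt u, hBalt v, hBalt w, hBalt z, huv, huw, huz, hvw, hvz,
        hBneg u v, hBneg u w, hBneg u z, hBneg v w, hBneg v z, hBneg w z]

theorem frobForm_normal_form (q : ℕ) (c : K) :
    frobForm q !![0, 1, 0, 0; -1, 0, 0, 0; 0, 0, 0, c; 0, 0, -c, 0] =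
      X 0 * X 1 ^ q - X 0 ^ q * X 1 + C c * (X 2 * X 3 ^ q - X 2 ^ q * X 3) := by
  simp [frobForm, Fin.sum_univ_four]
  ring

/-- A surface of degree `q+1` in `P^3` over `F_q` without `F_q`-plane
components whose defining form vanishes at every `F_q`-point of `P^3` is projectively
equivalent over `F_q` to the surface `X₀X₁^q - X₀^qX₁ + X₂X₃^q - X₂^qX₃ = 0`. -/
theorem surface_through_all_points (K : Type) [Field K] [Fintype K]
    (F : MvPolynomial (Fin 4) K)
    (hhom : F.IsHomogeneous (Fintype.card K + 1)) (hsf : Squarefree F)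
    (hnoplane : ¬ ∃ a : Fin 4 → K, a ≠ 0 ∧ linForm a ∣ F)
    (hall : ∀ v : Fin 4 → K, MvPolynomial.eval v F = 0) :
    ProjEquiv F (X 0 * X 1 ^ Fintype.card K - X 0 ^ Fintype.card K * X 1 +
      X 2 * X 3 ^ Fintype.card K - X 2 ^ Fintype.card K * X 3 :
      MvPolynomial (Fin 4) K) := by
  obtain ⟨A, rfl⟩ := exists_eq_frobForm hhom hall
  have hA : ∀ v : Fin 4 → K, v ⬝ᵥ A.mulVec v = 0 := by
    intro v
    have h := hall v
    rw [eval_frobForm] at h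
    simp only [FiniteField.pow_card] at h
    rw [← h]
    simp only [dotProduct, Matrix.mulVec, Finset.mul_sum]
    exact Finset.sum_congr rfl fun i _ => Finset.sum_congr rfl fun j _ => by ring
  have hA0 : A ≠ 0 := by
    rintro rfl
    exact hnoplane ⟨Pi.single 0 1, by simp, by simp [frobForm]⟩
  obtain ⟨M, hM, c, hc, hMA⟩ := exists_alternating_normal_form hA hA0
  have hsub := substLin_frobForm A M
  rw [hMA, frobForm_normal_form] at hsub
  rcases hc with rfl | rfl
  · refine absurd (exists_linForm_dvd_of_X_dvd_substLin hM (i := 0) ?_) hnoplane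
    rw [hsub, C_0, zero_mul, add_zero]
    exact dvd_sub (dvd_mul_right _ _)
      ((dvd_pow_self _ Fintype.card_ne_zero).mul_right _)
  · refine ⟨M, hM, 1, one_ne_zero, ?_⟩
    rw [hsub]
    simp only [C_1, one_mul]
    ring
end

section
/- Let F be a homogeneous polynomial of degree q+1 in F_q[X_0,X_1,X_2,X_3] that vanishes at every F_q-point of P^3. Then there is an alternating 4×4 matrix A over F_q (i.e., A^t = −A and all diagonal entries are 0) such that F(X_0,X_1,X_2,X_3) = (X_0,X_1,X_2,X_3)·A·(X_0^q,X_1^q,X_2^q,X_3^q)^t. -/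
open MvPolynomial

variable {K : Type} [Field K]

theorem Finsupp.single_one_add_single_inj {σ : Type*} {q : ℕ} (hq : 1 < q) {i j k l : σ}
    (h : Finsupp.single i 1 + Finsupp.single j q = Finsupp.single k 1 + Finsupp.single l q) :
    i = k ∧ j = l := by
  classical
  have hjl : j = l := by
    by_contra hne
    have := DFunLike.congr_fun h j
    simp only [Finsupp.add_apply, Finsupp.single_apply, if_neg (Ne.symm hne)] at this
    split_ifs at this <;> omega
  subst hjl
  exact ⟨Finsupp.single_left_injective one_ne_zero (add_right_cancel h), rfl⟩

namespace MvPolynomial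

variable {R σ : Type*} [CommRing R]

theorem C_mul_X_mul_X_pow (a : R) (i j : σ) (q : ℕ) :
    (C a * (X i * X j ^ q) : MvPolynomial σ R) =
      monomial (Finsupp.single i 1 + Finsupp.single j q) a := by
  rw [X_pow_eq_monomial, X, monomial_mul, C_mul_monomial]
  simp

/-- The matrix of coefficients of the monomials `Xᵢ Xⱼ ^ q` in a polynomial. -/
noncomputable def coeffMatrix (q : ℕ) (F : MvPolynomial σ R) : Matrix σ σ R :=
  fun i j => F.coeff (Finsupp.single i 1 + Finsupp.single j q)

variable [Fintype σ]

theorem coeff_sum_C_mul_X_mul_X_pow {q : ℕ} (hq : 1 < q) (A : Matrix σ σ R) (i j : σ) :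
    (∑ k, ∑ l, C (A k l) * (X k * X l ^ q) : MvPolynomial σ R).coeff
      (Finsupp.single i 1 + Finsupp.single j q) = A i j := by
  classical
  simp only [coeff_sum, C_mul_X_mul_X_pow, coeff_monomial]
  rw [Finset.sum_eq_single i, Finset.sum_eq_single j]
  · simp
  · intro l _ hl
    exact if_neg fun h => hl (Finsupp.single_one_add_single_inj hq h).2
  · simp
  · intro k _ hk
    exact Finset.sum_eq_zero fun l _ =>
      if_neg fun h => hk (Finsupp.single_one_add_single_inj hq h).1
  · simp

theorem isHomogeneous_sum_C_mul_X_mul_X_pow (q : ℕ) (A : Matrix σ σ R) :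
    (∑ k, ∑ l, C (A k l) * (X k * X l ^ q) : MvPolynomial σ R).IsHomogeneous (q + 1) := by
  refine IsHomogeneous.sum _ _ _ fun k _ => IsHomogeneous.sum _ _ _ fun l _ => ?_
  rw [C_mul_X_mul_X_pow]
  exact isHomogeneous_monomial _ (by simp [add_comm])

theorem sub_sum_coeffMatrix_mem_restrictDegree {q : ℕ} (hq : 1 < q) {F : MvPolynomial σ R}
    (hF : F.IsHomogeneous (q + 1)) :
    F - ∑ i, ∑ j, C (coeffMatrix q F i j) * (X i * X j ^ q) ∈ restrictDegree σ R (q - 1) := by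
  rw [mem_restrictDegree]
  intro m hm k
  rw [mem_support_iff] at hm
  by_contra! hk
  have hle : Finsupp.single k q ≤ m := Finsupp.single_le_iff.2 (by omega)
  have hdeg := (hF.sub (isHomogeneous_sum_C_mul_X_mul_X_pow q (coeffMatrix q F))) hm
  obtain ⟨m', rfl⟩ := exists_add_of_le hle
  rw [Pi.one_def, ← Finsupp.degree_eq_weight_one, map_add, Finsupp.degree_single] at hdeg
  obtain ⟨i, rfl⟩ := (Finsupp.sum_eq_one_iff m').1 (show m'.degree = 1 by omega)
  rw [add_comm] at hm
  apply hm
  rw [coeff_sub, coeff_sum_C_mul_X_mul_X_pow hq, coeffMatrix, sub_self]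

theorem IsHomogeneous.eval_single_one_eq_zero [DecidableEq σ] {n d : ℕ} (hd : d < n)
    {G : MvPolynomial σ R} (hG : G.IsHomogeneous n) (hGd : G ∈ restrictDegree σ R d) (i : σ) :
    eval (Pi.single i 1) G = 0 := by
  rw [mem_restrictDegree] at hGd
  rw [eval_eq']
  refine Finset.sum_eq_zero fun m hm => ?_
  have hdeg := hG (mem_support_iff.1 hm)
  rw [Pi.one_def, ← Finsupp.degree_eq_weight_one, Finsupp.degree_eq_sum] at hdeg
  obtain ⟨k, hk, hmk⟩ : ∃ k, k ≠ i ∧ m k ≠ 0 := by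
    by_contra! h
    rw [Finset.sum_eq_single i (fun k _ hk => h k hk) (by simp)] at hdeg
    have := hGd m hm i
    omega
  rw [Finset.prod_eq_zero (Finset.mem_univ k) (by simp [hk, hmk]), mul_zero]

theorem sum_C_mul_X_mul_X_mem_restrictDegree {A : Matrix σ σ R} (hA : ∀ i, A i i = 0) {d : ℕ}
    (hd : 1 ≤ d) :
    (∑ i, ∑ j, C (A i j) * (X i * X j ^ 1) : MvPolynomial σ R) ∈ restrictDegree σ R d := by
  classical
  refine Submodule.sum_mem _ fun i _ => Submodule.sum_mem _ fun j _ => ?_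
  rcases eq_or_ne i j with rfl | hij
  · simp [hA]
  rw [C_mul_X_mul_X_pow, mem_restrictDegree]
  intro m hm k
  obtain rfl := Finset.mem_singleton.1 (support_monomial_subset hm)
  simp only [Finsupp.add_apply, Finsupp.single_apply]
  split_ifs with h1 h2 <;> first | omega | exact absurd (h1.trans h2.symm) hij

theorem eval_single_one_sum_C_mul_X_mul_X_pow [DecidableEq σ] {q : ℕ} (hq : q ≠ 0)
    (A : Matrix σ σ R) (i : σ) :
    eval (Pi.single i 1) (∑ k, ∑ l, C (A k l) * (X k * X l ^ q)) = A i i := by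
  simp [Pi.single_apply, ite_pow, hq]

theorem eval_single_add_single_sum_C_mul_X_mul_X_pow [DecidableEq σ] {q : ℕ} (hq : q ≠ 0)
    (A : Matrix σ σ R) {i j : σ} (hij : i ≠ j) :
    eval (Pi.single i 1 + Pi.single j 1) (∑ k, ∑ l, C (A k l) * (X k * X l ^ q)) =
      A i i + A i j + (A j i + A j j) := by
  have hpow (l : σ) : ((Pi.single i 1 + Pi.single j 1 : σ → R) l) ^ q =
      (Pi.single i 1 + Pi.single j 1 : σ → R) l := by
    by_cases hi : l = i
    · subst hi; simp [hij]
    · by_cases hj : l = j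
      · subst hj; simp [hi]
      · simp [hi, hj, hq]
  simp only [map_sum, map_mul, map_pow, eval_C, eval_X, hpow]
  simp [Pi.single_apply, mul_add, Finset.sum_add_distrib]
  ring

/-- Over a finite field with `q` elements, a form of degree `q + 1` vanishing at all rational
points is a combination of the `Xᵢ Xⱼ ^ q`. -/
theorem IsHomogeneous.eq_sum_coeffMatrix_of_eval_eq_zero {k σ : Type} [Field k] [Fintype k]
    [Fintype σ] {F : MvPolynomial σ k} (hF : F.IsHomogeneous (Fintype.card k + 1))
    (h0 : ∀ v, eval v F = 0) :
    (∀ i, coeffMatrix (Fintype.card k) F i i = 0) ∧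
      F = ∑ i, ∑ j, C (coeffMatrix (Fintype.card k) F i j) * (X i * X j ^ Fintype.card k) := by
  classical
  have hq : 1 < Fintype.card k := Fintype.one_lt_card
  set A := coeffMatrix (Fintype.card k) F with hA
  set S := ∑ i, ∑ j, C (A i j) * (X i * X j ^ Fintype.card k) with hS
  have hmem : F - S ∈ restrictDegree σ k (Fintype.card k - 1) :=
    sub_sum_coeffMatrix_mem_restrictDegree hq hF
  have hG : (F - S).IsHomogeneous (Fintype.card k + 1) :=
    hF.sub (isHomogeneous_sum_C_mul_X_mul_X_pow _ A)
  have hdiag (i : σ) : A i i = 0 := by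
    have := hG.eval_single_one_eq_zero (by omega) hmem i
    rw [map_sub, h0, hS, eval_single_one_sum_C_mul_X_mul_X_pow (by omega)] at this
    simpa using this
  refine ⟨hdiag, ?_⟩
  have hQ := isHomogeneous_sum_C_mul_X_mul_X_pow 1 A
  set Q := ∑ i, ∑ j, C (A i j) * (X i * X j ^ 1) with hQdef
  have hR : F - S + Q = 0 := by
    refine eq_zero_of_eval_eq_zero _ _ _ (fun v => ?_)
      (add_mem hmem (sum_C_mul_X_mul_X_mem_restrictDegree hdiag (by omega)))
    rw [map_add, map_sub, h0, hS, hQdef]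
    simp [FiniteField.pow_card]
  have hcomp := congrArg (homogeneousComponent (Fintype.card k + 1)) hR
  rw [map_add, homogeneousComponent_of_mem hG, homogeneousComponent_of_mem hQ, if_pos rfl,
    if_neg (by omega), add_zero, map_zero] at hcomp
  exact sub_eq_zero.1 hcomp

end MvPolynomial

/-- A homogeneous polynomial of degree `q+1` in `F_q[X₀,X₁,X₂,X₃]`
vanishing at every `F_q`-point of `P^3` is of the form `X·A·(X^q)ᵗ` for some alternating
`4×4` matrix `A` over `F_q` (i.e. `Aᵗ = -A` with zero diagonal). -/
theorem vanishing_form_is_alternating (K : Type) [Field K] [Fintype K]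
    (F : MvPolynomial (Fin 4) K)
    (hhom : F.IsHomogeneous (Fintype.card K + 1))
    (hall : ∀ v : Fin 4 → K, MvPolynomial.eval v F = 0) :
    ∃ A : Matrix (Fin 4) (Fin 4) K, A.transpose = -A ∧ (∀ i, A i i = 0) ∧
      F = ∑ i, ∑ j, C (A i j) * (X i * X j ^ Fintype.card K) := by
  have hq : Fintype.card K ≠ 0 := Fintype.card_ne_zero
  obtain ⟨hdiag, hF⟩ := hhom.eq_sum_coeffMatrix_of_eval_eq_zero hall
  refine ⟨coeffMatrix (Fintype.card K) F, ?_, hdiag, hF⟩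
  ext i j
  rw [Matrix.transpose_apply, Matrix.neg_apply]
  rcases eq_or_ne i j with rfl | hij
  · simp [hdiag]
  have h := hall (Pi.single i 1 + Pi.single j 1)
  rw [hF, eval_single_add_single_sum_C_mul_X_mul_X_pow hq _ hij, hdiag, hdiag, zero_add,
    add_zero] at h
  exact eq_neg_of_add_eq_zero_right h
end

section
/- The plane curve over F_4 defined by (X+Y+Z)^4 + (XY+YZ+ZX)^2 + XYZ(X+Y+Z) = 0 has exactly 14 points in P^2(F_4). -/
open MvPolynomial

variable {K : Type} [Field K]

/-- The number of points of a projective space satisfying a homogeneous condition `P`, times the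
number of units, is the number of nonzero vectors satisfying `P`. -/
theorem card_subtype_projectivization_mul {k V : Type*} [Field k] [AddCommGroup V] [Module k V]
    (P : V → Prop) (hP : ∀ (a : kˣ) (v : V), P (a • v) ↔ P v) :
    Nat.card {p : Projectivization k V // P p.rep} * Nat.card kˣ =
      Nat.card {v : V // v ≠ 0 ∧ P v} := by
  rw [← Nat.card_prod]
  refine Nat.card_eq_of_bijective (fun x => ⟨x.2 • x.1.1.rep,
    (smul_ne_zero_iff_ne x.2).2 x.1.1.rep_nonzero, (hP _ _).2 x.1.2⟩) ⟨?_, ?_⟩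
  · rintro ⟨⟨p, hp⟩, a⟩ ⟨⟨q, hq⟩, b⟩ h
    have hab : a • p.rep = b • q.rep := congrArg Subtype.val h
    obtain rfl : p = q := by
      rw [← p.mk_rep, ← q.mk_rep, Projectivization.mk_eq_mk_iff]
      exact ⟨a⁻¹ * b, by rw [mul_smul, ← hab, inv_smul_smul]⟩
    have : (a : k) = b := smul_left_injective k p.rep_nonzero hab
    rw [Units.ext this]
  · rintro ⟨v, hv, hPv⟩
    obtain ⟨a, ha⟩ := Projectivization.exists_smul_eq_mk_rep k v hv
    refine ⟨⟨⟨Projectivization.mk k v hv, ?_⟩, a⁻¹⟩, ?_⟩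
    · rwa [← ha, hP]
    · simp [← ha]

/-- The quartic form `(x+y+z)⁴ + (xy+yz+zx)² + xyz(x+y+z)`. -/
def exceptionalForm {R : Type*} [CommRing R] (x y z : R) : R :=
  (x + y + z) ^ 4 + (x * y + y * z + z * x) ^ 2 + x * y * z * (x + y + z)

theorem exceptionalForm_mul {R : Type*} [CommRing R] (a x y z : R) :
    exceptionalForm (a * x) (a * y) (a * z) = a ^ 4 * exceptionalForm x y z := by
  simp only [exceptionalForm]
  ring

theorem map_exceptionalForm {R S : Type*} [CommRing R] [CommRing S] (f : R →+* S) (x y z : R) :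
    f (exceptionalForm x y z) = exceptionalForm (f x) (f y) (f z) := by
  simp [exceptionalForm]

/-- The field with four elements, as `F₂[ω]` with `ω² = 1 + ω`. -/
abbrev FieldFour : Type := QuadraticAlgebra (ZMod 2) 1 1

instance : Fact (∀ r : ZMod 2, r ^ 2 ≠ 1 + 1 * r) := ⟨by decide⟩

instance : Fintype FieldFour := Fintype.ofEquiv _ (QuadraticAlgebra.equivProd 1 1).symm

theorem card_fieldFour : Fintype.card FieldFour = 4 := by decide

theorem card_nonzero_zeros_exceptionalForm_fieldFour :
    Fintype.card {v : FieldFour × FieldFour × FieldFour //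
      v ≠ 0 ∧ exceptionalForm v.1 v.2.1 v.2.2 = 0} = 42 := by
  decide +kernel

theorem card_nonzero_zeros_exceptionalForm {k : Type*} [Field k] [Fintype k]
    (hk : Fintype.card k = 4) :
    Nat.card {v : Fin 3 → k // v ≠ 0 ∧ exceptionalForm (v 0) (v 1) (v 2) = 0} = 42 := by
  let e : k ≃+* FieldFour := FiniteField.ringEquivOfCardEq (hk.trans card_fieldFour.symm)
  rw [← card_nonzero_zeros_exceptionalForm_fieldFour, ← Nat.card_eq_fintype_card]
  refine Nat.card_congr (Equiv.subtypeEquiv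
    ⟨fun v => (e (v 0), e (v 1), e (v 2)), fun w => ![e.symm w.1, e.symm w.2.1, e.symm w.2.2],
      fun v => by ext i; fin_cases i <;> simp, fun w => by simp⟩ fun v => ?_)
  have h : exceptionalForm (e (v 0)) (e (v 1)) (e (v 2)) = e (exceptionalForm (v 0) (v 1) (v 2)) :=
    (map_exceptionalForm (e : k →+* FieldFour) ..).symm
  simp [h, funext_iff, Fin.forall_fin_succ, Prod.ext_iff]

/-- The plane curve over `F_4` defined by
`(X+Y+Z)⁴ + (XY+YZ+ZX)² + XYZ(X+Y+Z) = 0` has exactly `14` points in `P²(F_4)`. -/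
theorem exceptional_quartic_has_14_points (K : Type) [Field K] [Fintype K]
    (hq : Fintype.card K = 4) :
    Nat.card {p : Projectivization K (Fin 3 → K) //
      MvPolynomial.eval p.rep
        ((X 0 + X 1 + X 2) ^ 4 + (X 0 * X 1 + X 1 * X 2 + X 2 * X 0) ^ 2 +
          X 0 * X 1 * X 2 * (X 0 + X 1 + X 2) : MvPolynomial (Fin 3) K) = 0} = 14 := by
  have hF := card_subtype_projectivization_mul (k := K) (V := Fin 3 → K)
    (fun v => exceptionalForm (v 0) (v 1) (v 2) = 0) fun a v => by
      simp [Pi.smul_apply, Units.smul_def, exceptionalForm_mul]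
  rw [card_nonzero_zeros_exceptionalForm hq, Nat.card_units, Nat.card_eq_fintype_card (α := K), hq] at hF
  simp only [map_add, map_mul, map_pow, eval_X]
  simp only [exceptionalForm] at hF
  omega
end
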